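/- arXiv:0903.5361 — 2 statements merged into one kernel-verified Lean document; each statement's English description precedes it below -/
import Mathlib

section
/- Let D be a disk-polygon in the Euclidean plane with center parameter d, where 1 ≤ d < √3. Then the area of D is at least the area of the regular disk-triangle Δ(d); explicitly, volume(D) ≥ 3·arccos(d/2) + (√3/4)·d² − (3/4)·d·√(4 − d²) − π/2. -/
open Metric Real MeasureTheory
open scoped InnerProductSpace Pointwise ENNReal

noncomputable section

/-- The Euclidean plane. -/
abbrev E2 := EuclideanSpace ℝ (Fin 2)

/-- The point of the Euclidean plane with the given coordinates. -/
def pt (a b : ℝ) : E2 := (EuclideanSpace.equiv (Fin 2) ℝ).symm ![a, b]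

/-- The width of a set `C` in the direction of the unit vector `u`. -/
def dirWidth (C : Set E2) (u : E2) : ℝ :=
  sSup {w : ℝ | ∃ x ∈ C, ∃ y ∈ C, w = ⟪x - y, u⟫_ℝ}

/-- The minimal width of a set: the infimum of the directional widths over all
unit vectors. -/
def minWidth (C : Set E2) : ℝ :=
  sInf {w : ℝ | ∃ u : E2, ‖u‖ = 1 ∧ w = dirWidth C u}

/-- The inradius of a set. -/
def inradius (C : Set E2) : ℝ :=
  sSup {r : ℝ | 0 ≤ r ∧ ∃ c : E2, closedBall c r ⊆ C}

/-- The circumradius of a set. -/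
def circumradius (C : Set E2) : ℝ :=
  sInf {r : ℝ | 0 ≤ r ∧ ∃ c : E2, C ⊆ closedBall c r}

/-- The dual disk-polygon of a set `D`. -/
def dualDP (D : Set E2) : Set E2 := {y : E2 | ∀ x ∈ D, dist x y ≤ 1}

/-! ### Elementary planar lemmas, with the plane modelled by `ℂ` -/

/-- Squared norm. -/
def Qn (z : ℂ) : ℝ := z.re ^ 2 + z.im ^ 2

/-- Inner product with the unit vector of angle `t`. -/
def ipr (z : ℂ) (t : ℝ) : ℝ := z.re * Real.cos t + z.im * Real.sin t

/-- Inner product with the unit vector of angle `t + π/2`. -/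
def jpr (z : ℂ) (t : ℝ) : ℝ := z.im * Real.cos t - z.re * Real.sin t

/-- Unit vector of angle `t`. -/
def uvec (t : ℝ) : ℂ := ⟨Real.cos t, Real.sin t⟩

lemma Qn_eq (z : ℂ) : Qn z = ‖z‖ ^ 2 := by
  rw [Complex.sq_norm, Complex.normSq_apply, Qn]; ring

lemma Qn_nonneg (z : ℂ) : 0 ≤ Qn z := by unfold Qn; positivity

lemma Qn_pos {z : ℂ} (h : z ≠ 0) : 0 < Qn z := by
  rw [Qn_eq]; have := norm_pos_iff.2 h; positivity

lemma Qn_rot (z : ℂ) (t : ℝ) : Qn z = ipr z t ^ 2 + jpr z t ^ 2 := by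
  unfold Qn ipr jpr
  have := Real.sin_sq_add_cos_sq t
  linear_combination (-(z.re ^ 2 + z.im ^ 2)) * this

lemma Qn_add_smul (z : ℂ) (r t : ℝ) :
    Qn (z + r * uvec t) = Qn z + 2 * r * ipr z t + r ^ 2 := by
  unfold Qn ipr uvec
  have := Real.sin_sq_add_cos_sq t
  simp
  linear_combination (r ^ 2) * this

lemma ipr_comb (z : ℂ) (θ ω t : ℝ) :
    Real.sin (2 * ω) * ipr z (θ + t) =
      Real.sin (ω - t) * ipr z (θ - ω) + Real.sin (ω + t) * ipr z (θ + ω) := by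
  unfold ipr
  simp only [Real.sin_two_mul, Real.sin_add, Real.sin_sub, Real.cos_add, Real.cos_sub]
  have h1 := Real.sin_sq_add_cos_sq ω
  have h2 : Real.sin ω ^ 2 = 1 - Real.cos ω ^ 2 := by linarith
  ring

lemma cone_lemma {y c1 c2 q : ℂ} {r θ ω t : ℝ} 
    (h1 : c1 = q - r * uvec (θ - ω)) (h2 : c2 = q - r * uvec (θ + ω))
    (hy1 : Qn (y - c1) ≤ r ^ 2) (hy2 : Qn (y - c2) ≤ r ^ 2)
    (hω : 0 < ω) (hω' : ω < π / 2) (ht : |t| ≤ ω) :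
    2 * r * ipr (y - q) (θ + t) ≤ - Qn (y - q) := by
  have e1 : y - c1 = (y - q) + r * uvec (θ - ω) := by rw [h1]; ring
  have e2 : y - c2 = (y - q) + r * uvec (θ + ω) := by rw [h2]; ring
  rw [e1, Qn_add_smul] at hy1
  rw [e2, Qn_add_smul] at hy2
  obtain ⟨ht1, ht2⟩ := abs_le.1 ht
  have s1 : 0 ≤ Real.sin (ω - t) := Real.sin_nonneg_of_nonneg_of_le_pi (by linarith) (by linarith)
  have s2 : 0 ≤ Real.sin (ω + t) := Real.sin_nonneg_of_nonneg_of_le_pi (by linarith) (by linarith)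
  have s3 : 0 < Real.sin (2 * ω) := Real.sin_pos_of_pos_of_lt_pi (by linarith) (by linarith)
  have s4 : Real.sin (2 * ω) ≤ Real.sin (ω - t) + Real.sin (ω + t) := by
    have hc : Real.cos ω ≤ Real.cos t := by
      rw [← Real.cos_abs t]
      exact Real.cos_le_cos_of_nonneg_of_le_pi (abs_nonneg _) (by linarith) ht
    have hs : 0 < Real.sin ω := Real.sin_pos_of_pos_of_lt_pi hω (by linarith)
    rw [Real.sin_two_mul, Real.sin_sub, Real.sin_add]
    nlinarith
  have key := ipr_comb (y - q) θ ω t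
  have hQ := Qn_nonneg (y - q)
  have : Real.sin (2 * ω) * (2 * r * ipr (y - q) (θ + t)) ≤ Real.sin (2 * ω) * (- Qn (y - q)) := by
    have a1 := mul_le_mul_of_nonneg_left (show 2 * r * ipr (y - q) (θ - ω) ≤ - Qn (y - q) by linarith) s1
    have a2 := mul_le_mul_of_nonneg_left (show 2 * r * ipr (y - q) (θ + ω) ≤ - Qn (y - q) by linarith) s2
    have a3 := mul_le_mul_of_nonneg_right s4 hQ
    calc _ = 2 * r * (Real.sin (2 * ω) * ipr (y - q) (θ + t)) := by ring
      _ = Real.sin (ω - t) * (2 * r * ipr (y - q) (θ - ω))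
          + Real.sin (ω + t) * (2 * r * ipr (y - q) (θ + ω)) := by rw [key]; ring
      _ ≤ _ := by nlinarith
  exact le_of_mul_le_mul_left this s3

/-- Real-coordinates version of the lens lemma. -/
lemma lens_real {X Y P R a H Hd : ℝ} (ha : 0 < a) (hH : 0 < H) (haH : a ^ 2 + H ^ 2 = 1)
    (hHd : H ≤ Hd)
    (hc : X ^ 2 + (Y - H) ^ 2 ≤ 1) (hp : a ^ 2 + Hd ^ 2 < X ^ 2 + (Y - Hd) ^ 2)
    (hy1 : (P - a) ^ 2 + R ^ 2 < 1) (hy2 : (P + a) ^ 2 + R ^ 2 < 1) :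
    (P - X) ^ 2 + (R - Y) ^ 2 < 1 := by
  have h1 : X ^ 2 + Y ^ 2 - 2 * Y * H ≤ a ^ 2 := by nlinarith
  have h2 : a ^ 2 < X ^ 2 + Y ^ 2 - 2 * Y * Hd := by nlinarith
  have hY : Y < 0 := by
    by_contra hY
    push Not at hY
    nlinarith
  have hXa : |X| ≤ a := abs_le_of_sq_le_sq (by nlinarith) ha.le
  have hP : P ^ 2 + R ^ 2 + 2 * a * |P| < H ^ 2 := by
    rcases abs_cases P with ⟨h, _⟩ | ⟨h, _⟩ <;> rw [h] <;> nlinarith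
  have hR : |R| ≤ H := abs_le_of_sq_le_sq (by nlinarith [abs_nonneg P]) hH.le
  have b1 : -(P * X) ≤ |P| * a := by
    calc -(P * X) ≤ |P * X| := neg_le_abs _
      _ = |P| * |X| := abs_mul _ _
      _ ≤ _ := by gcongr
  have b2 : -(R * Y) ≤ H * (-Y) := by
    have := neg_abs_le R
    have := le_abs_self R
    nlinarith
  nlinarith

lemma ipr_sub (a b : ℂ) (t : ℝ) : ipr (a - b) t = ipr a t - ipr b t := by
  simp only [ipr, Complex.sub_re, Complex.sub_im]; ring

lemma jpr_sub (a b : ℂ) (t : ℝ) : jpr (a - b) t = jpr a t - jpr b t := by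
  simp only [jpr, Complex.sub_re, Complex.sub_im]; ring

lemma ipr_add (a b : ℂ) (t : ℝ) : ipr (a + b) t = ipr a t + ipr b t := by
  simp only [ipr, Complex.add_re, Complex.add_im]; ring

lemma jpr_add (a b : ℂ) (t : ℝ) : jpr (a + b) t = jpr a t + jpr b t := by
  simp only [jpr, Complex.add_re, Complex.add_im]; ring

lemma ipr_uvec (s t : ℝ) : ipr (uvec s) t = Real.cos (s - t) := by
  simp [ipr, uvec, Real.cos_sub]

lemma jpr_uvec (s t : ℝ) : jpr (uvec s) t = Real.sin (s - t) := by
  simp [jpr, uvec, Real.sin_sub]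

lemma ipr_smul (r : ℝ) (z : ℂ) (t : ℝ) : ipr (r * z) t = r * ipr z t := by
  simp [ipr]; ring

lemma jpr_smul (r : ℝ) (z : ℂ) (t : ℝ) : jpr (r * z) t = r * jpr z t := by
  simp [jpr]; ring

lemma lens_lemma {x c1 c2 c y p : ℂ} {d θ ω η : ℝ} (hd : 1 ≤ d)
    (h1 : c1 = x - uvec (θ - ω)) (h2 : c2 = x - uvec (θ + ω))
    (hω : 0 < ω) (hω' : ω < π / 2) (hη : 0 < η) (hη' : η < π / 2)
    (hs : d * Real.sin η = Real.sin ω)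
    (hp : p = x + (d * Real.cos η - Real.cos ω : ℝ) * uvec θ)
    (hxc : Qn (x - c) ≤ 1) (hpc : d ^ 2 < Qn (p - c))
    (hy1 : Qn (y - c1) < 1) (hy2 : Qn (y - c2) < 1) : Qn (y - c) < 1 := by
  have sω : 0 < Real.sin ω := Real.sin_pos_of_pos_of_lt_pi hω (by linarith)
  have cω : 0 < Real.cos ω := Real.cos_pos_of_mem_Ioo ⟨by linarith, hω'⟩
  have cη : 0 < Real.cos η := Real.cos_pos_of_mem_Ioo ⟨by linarith, hη'⟩
  have pω := Real.sin_sq_add_cos_sq ω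
  have pη := Real.sin_sq_add_cos_sq η
  have pθ := Real.sin_sq_add_cos_sq θ
  have pθ' : Real.sin θ ^ 2 = 1 - Real.cos θ ^ 2 := by linarith
  have hH : Real.cos ω ≤ d * Real.cos η := by
    apply le_of_sq_le_sq _ (by positivity)
    have : (d * Real.cos η) ^ 2 = d ^ 2 - Real.sin ω ^ 2 := by
      rw [← hs]; linear_combination (d ^ 2) * pη
    rw [this]; nlinarith
  have hds : d ^ 2 = Real.sin ω ^ 2 + (d * Real.cos η) ^ 2 := by
    rw [← hs]; linear_combination (-d ^ 2) * pη
  rw [Qn_rot _ θ] at hxc hpc hy1 hy2 ⊢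
  simp only [h1, h2, hp, ipr_sub, jpr_sub, ipr_add, jpr_add, ipr_smul, jpr_smul, ipr_uvec,
    jpr_uvec, sub_self, Real.cos_zero, Real.sin_zero, sub_sub_cancel_left, add_sub_cancel_left,
    Real.cos_neg, Real.sin_neg] at hxc hpc hy1 hy2 ⊢
  have key := lens_real (X := jpr c θ - jpr x θ) (Y := ipr c θ - ipr x θ + Real.cos ω)
    (P := jpr y θ - jpr x θ) (R := ipr y θ - ipr x θ + Real.cos ω) sω cω pω hH
    (le_of_eq_of_le (by ring) hxc) ((hds.symm.trans_lt hpc).trans_eq (by ring))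
    (lt_of_eq_of_lt (by ring) hy1) (lt_of_eq_of_lt (by ring) hy2)
  exact lt_of_eq_of_lt (by ring) key

/-- Intersection of the closed disks of radius `r` centered at `S`. -/
def capB (S : Finset ℂ) (r : ℝ) : Set ℂ := {y | ∀ c ∈ S, Qn (y - c) ≤ r ^ 2}

lemma Qn_le_iff {z : ℂ} {r : ℝ} (hr : 0 ≤ r) : Qn z ≤ r ^ 2 ↔ ‖z‖ ≤ r := by
  rw [Qn_eq]; exact sq_le_sq₀ (norm_nonneg _) hr

lemma capB_eq (S : Finset ℂ) {r : ℝ} (hr : 0 ≤ r) : capB S r = ⋂ c ∈ S, closedBall c r := by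
  ext y
  simp [capB, Qn_le_iff hr, dist_eq_norm]

lemma capB_compact {S : Finset ℂ} (hS : S.Nonempty) {r : ℝ} (hr : 0 ≤ r) :
    IsCompact (capB S r) := by
  rw [capB_eq S hr]
  obtain ⟨c, hc⟩ := hS
  apply IsCompact.of_isClosed_subset (isCompact_closedBall c r)
  · exact isClosed_biInter fun c _ => isClosed_closedBall
  · exact Set.biInter_subset_of_mem (by simpa using hc)

lemma ipr_le_sqrt (z : ℂ) (t b : ℝ) (hb : 0 ≤ b) (h : Qn z ≤ b ^ 2) : ipr z t ≤ b := by
  rw [Qn_rot z t] at h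
  exact le_of_sq_le_sq (by nlinarith [sq_nonneg (jpr z t)]) hb

lemma rolling {S : Finset ℂ} {r : ℝ} (hr : 0 < r) {x y : ℂ} {φ : ℝ}
    (hx : x ∈ capB S r) (hmax : ∀ y ∈ capB S r, ipr y φ ≤ ipr x φ) (hy : y ∈ capB S r) :
    2 * r * ipr (y - x) φ ≤ - Qn (y - x) := by
  set I := ipr (y - x) φ with hI
  set L := Qn (y - x) with hL
  have key : ∀ t : ℝ, 0 < t → t < 1 → 2 * r * I + (1 - t) * L ≤ 0 := by
    intro t ht0 ht1
    have hL0 : 0 ≤ L := Qn_nonneg _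
    set τ := t * (1 - t) * L / (2 * r) with hτ
    have hτ0 : 0 ≤ τ := by
      apply div_nonneg _ (by linarith)
      exact mul_nonneg (mul_nonneg ht0.le (by linarith)) hL0
    have hτr : 2 * r * τ = t * (1 - t) * L := by rw [hτ]; field_simp
    have hw : x + (t : ℂ) * (y - x) + τ * uvec φ ∈ capB S r := by
      intro c hc
      have e : x + (t : ℂ) * (y - x) + τ * uvec φ - c
        = (x + (t : ℂ) * (y - x) - c) + τ * uvec φ := by ring
      rw [e, Qn_add_smul]
      have h1 : Qn (x + (t : ℂ) * (y - x) - c)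
          = (1 - t) * Qn (x - c) + t * Qn (y - c) - t * (1 - t) * L := by
        rw [hL]; simp [Qn]; ring
      have h2 : Qn (x + (t : ℂ) * (y - x) - c) ≤ r ^ 2 - 2 * r * τ := by
        rw [h1, hτr]
        have := hx c hc
        have := hy c hc
        nlinarith
      have h3 := Qn_nonneg (x + (t : ℂ) * (y - x) - c)
      have h4 : τ ≤ r := by nlinarith
      have h5 : ipr (x + (t : ℂ) * (y - x) - c) φ ≤ r - τ :=
        ipr_le_sqrt _ _ _ (by linarith) (by nlinarith)
      nlinarith
    have h6 := hmax _ hw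
    rw [ipr_add, ipr_add, ipr_smul, ipr_smul, ipr_uvec, sub_self, Real.cos_zero, ← hI] at h6
    have h7 : t * I + τ ≤ 0 := by linarith
    have h8 : t * (2 * r * I + (1 - t) * L) ≤ 0 := by nlinarith
    by_contra h9
    push Not at h9
    nlinarith [mul_pos ht0 h9]
  by_contra hcon
  push Not at hcon
  have hL0 : 0 ≤ L := Qn_nonneg _
  have hI0 : I ≤ 0 := by
    have := hmax y hy
    rw [hI, ipr_sub]; linarith
  have hLpos : 0 < L := by nlinarith
  have := key ((2 * r * I + L) / (2 * L)) (div_pos (by linarith) (by linarith))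
    (by rw [div_lt_one (by linarith)]; nlinarith)
  have e : (1 - (2 * r * I + L) / (2 * L)) * L = L - (2 * r * I + L) / 2 := by field_simp
  rw [e] at this
  linarith

/-! ### Support functions on the circle -/

instance fact_two_pi_pos' : Fact (0 < 2 * π) := ⟨Real.two_pi_pos⟩

/-- The circle of directions. -/
abbrev Circ := AddCircle (2 * π)

def cosC : Circ → ℝ := Real.cos_periodic.lift
def sinC : Circ → ℝ := Real.sin_periodic.lift

@[simp] lemma cosC_coe (t : ℝ) : cosC (t : Circ) = Real.cos t := rfl
@[simp] lemma sinC_coe (t : ℝ) : sinC (t : Circ) = Real.sin t := rfl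

lemma continuous_cosC : Continuous cosC := continuous_coinduced_dom.mpr Real.continuous_cos
lemma continuous_sinC : Continuous sinC := continuous_coinduced_dom.mpr Real.continuous_sin

def iprC (z : ℂ) (φ : Circ) : ℝ := z.re * cosC φ + z.im * sinC φ

@[simp] lemma iprC_coe (z : ℂ) (t : ℝ) : iprC z (t : Circ) = ipr z t := rfl

lemma circ_rep (φ : Circ) : ∃ t : ℝ, (t : Circ) = φ := QuotientAddGroup.mk_surjective φ

/-- Support function. -/
def hsup (T : Set ℂ) (φ : Circ) : ℝ := sSup ((fun y => iprC y φ) '' T)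

lemma continuous_hsup {T : Set ℂ} (hT : IsCompact T) : Continuous (hsup T) := by
  unfold hsup
  apply IsCompact.continuous_sSup hT
  unfold iprC
  have := continuous_cosC
  have := continuous_sinC
  simp only [Function.HasUncurry.uncurry]
  fun_prop

lemma hsup_attain {T : Set ℂ} (hT : IsCompact T) (hne : T.Nonempty) (φ : Circ) :
    ∃ x ∈ T, iprC x φ = hsup T φ ∧ ∀ y ∈ T, iprC y φ ≤ iprC x φ := by
  have hc : ContinuousOn (fun y : ℂ => iprC y φ) T := by
    unfold iprC; fun_prop
  obtain ⟨x, hx, hx1, hx2⟩ := hT.exists_sSup_image_eq_and_ge hne hc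
  exact ⟨x, hx, hx1.symm, hx2⟩

lemma circ_dist_le {θ : ℝ} {φ : Circ} {ε : ℝ} (h : φ ∈ closedBall (θ : Circ) ε) :
    ∃ t : ℝ, |t| ≤ ε ∧ φ = ((θ + t : ℝ) : Circ) := by
  obtain ⟨s, rfl⟩ := circ_rep φ
  rw [mem_closedBall, dist_eq_norm, ← AddCircle.coe_sub, AddCircle.norm_eq] at h
  refine ⟨_, h, ?_⟩
  rw [show θ + (s - θ - round ((2 * π)⁻¹ * (s - θ)) * (2 * π))
    = s - (round ((2 * π)⁻¹ * (s - θ)) : ℤ) • (2 * π) by rw [zsmul_eq_mul]; ring]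
  rw [AddCircle.coe_sub, AddCircle.coe_zsmul, AddCircle.coe_period, smul_zero, sub_zero]

lemma circ_mem_of {θ t ε : ℝ} (h : |t| ≤ ε) : ((θ + t : ℝ) : Circ) ∈ closedBall (θ : Circ) ε := by
  rw [mem_closedBall, dist_eq_norm, ← AddCircle.coe_sub, add_sub_cancel_left]
  refine le_trans ?_ h
  exact QuotientAddGroup.norm_mk_le_norm

lemma ipr_add_pi (z : ℂ) (t : ℝ) : ipr z (t + π) = - ipr z t := by
  simp [ipr]; ring

lemma ipr_shift (z : ℂ) (t ε : ℝ) :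
    ipr z (t + ε) + ipr z (t - ε) = 2 * Real.cos ε * ipr z t := by
  simp only [ipr, Real.cos_add, Real.cos_sub, Real.sin_add, Real.sin_sub]; ring

lemma hsup_ge {T : Set ℂ} (hT : IsCompact T) {y : ℂ} (hy : y ∈ T) (φ : Circ) :
    iprC y φ ≤ hsup T φ := by
  obtain ⟨x, hx, hx1, hx2⟩ := hsup_attain hT ⟨y, hy⟩ φ
  rw [← hx1]; exact hx2 y hy

/-- The three properties of the support function of an intersection of disks of radius `r`
whose centers have mutual distances at most `r`. -/
lemma hsup_props {S : Finset ℂ} (hS : S.Nonempty) {r : ℝ} (hr : 0 < r)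
    (hdiam : ∀ c ∈ S, ∀ c' ∈ S, Qn (c - c') ≤ r ^ 2) (φ : Circ) :
    r ≤ hsup (capB S r) φ + hsup (capB S r) (φ + (π : ℝ)) ∧
    ∀ ε : ℝ, hsup (capB S r) (φ + (ε : ℝ)) + hsup (capB S r) (φ + ((-ε : ℝ) : Circ))
      ≤ 2 * Real.cos ε * hsup (capB S r) φ + 2 * r * (1 - Real.cos ε) := by
  have hT := capB_compact hS hr.le
  obtain ⟨c0, hc0⟩ := hS
  have hne : (capB S r).Nonempty := ⟨c0, fun c hc => hdiam c0 hc0 c hc⟩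
  obtain ⟨t, rfl⟩ := circ_rep φ
  obtain ⟨x, hx, hx1, hx2⟩ := hsup_attain hT hne (t : Circ)
  simp only [iprC_coe] at hx1 hx2
  have hroll : ∀ y ∈ capB S r, Qn (y - (x - r * uvec t)) ≤ r ^ 2 := by
    intro y hy
    have := rolling hr hx hx2 hy
    rw [show y - (x - r * uvec t) = (y - x) + r * uvec t by ring, Qn_add_smul]
    linarith
  have hz : (x - r * uvec t) ∈ capB S r := by
    intro c hc
    have := hroll c (fun c' hc' => hdiam c hc c' hc')
    rwa [show Qn (x - r * uvec t - c) = Qn (c - (x - r * uvec t)) by simp only [Qn_eq, norm_sub_rev]]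
  have hzt : ∀ s, ipr (x - r * uvec t) s = ipr x s - r * Real.cos (t - s) := by
    intro s; rw [ipr_sub, ipr_smul, ipr_uvec]
  constructor
  · have := hsup_ge hT hz ((t : Circ) + (π : ℝ))
    rw [← AddCircle.coe_add, iprC_coe, ipr_add_pi, hzt, sub_self, Real.cos_zero, hx1] at this
    rw [← AddCircle.coe_add]
    linarith
  · intro ε
    have hb : ∀ s : ℝ, hsup (capB S r) (s : Circ) ≤ ipr (x - r * uvec t) s + r := by
      intro s
      obtain ⟨y, hy, hy1, -⟩ := hsup_attain hT hne (s : Circ)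
      rw [← hy1, iprC_coe]
      have := ipr_le_sqrt _ s r hr.le (hroll y hy)
      rw [ipr_sub] at this
      linarith
    have h1 := hb (t + ε)
    have h2 := hb (t - ε)
    have h3 := ipr_shift (x - r * uvec t) t ε
    have h4 := hzt t
    rw [sub_self, Real.cos_zero, hx1] at h4
    rw [h4] at h3
    rw [← AddCircle.coe_add, ← AddCircle.coe_add, ← sub_eq_add_neg]
    nlinarith

lemma cauchy_bound {S : Finset ℂ} (hS : S.Nonempty) {r : ℝ} (hr : 0 < r)
    (hdiam : ∀ c ∈ S, ∀ c' ∈ S, Qn (c - c') ≤ r ^ 2)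
    (X : Finset ℂ) (θ η : ℂ → ℝ) (p : ℂ → ℂ)
    (hη : ∀ x ∈ X, 0 < η x ∧ η x < π / 2) (hp : ∀ x ∈ X, p x ∈ capB S r)
    (hsupp : ∀ x ∈ X, ∀ y ∈ capB S r, ∀ t, |t| ≤ η x → ipr y (θ x + t) ≤ ipr (p x) (θ x + t))
    (hdisj : ∀ x ∈ X, ∀ y ∈ X, x ≠ y →
      Disjoint (closedBall (θ x : Circ) (η x)) (closedBall (θ y : Circ) (η y))) :
    ∑ x ∈ X, 2 * η x ≤ π := by
  have hT := capB_compact hS hr.le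
  have hne : (capB S r).Nonempty := by
    obtain ⟨c0, hc0⟩ := hS
    exact ⟨c0, fun c hc => hdiam c0 hc0 c hc⟩
  set h := hsup (capB S r) with hh
  have hcont : Continuous h := continuous_hsup hT
  have hint : ∀ f : Circ → ℝ, Continuous f → Integrable f volume := by
    intro f hf
    exact integrableOn_univ.1 (hf.continuousOn.integrableOn_compact isCompact_univ)
  have hshift : ∀ s : Circ, ∫ φ, h (φ + s) = ∫ φ, h φ := fun s => integral_add_right_eq_self h s
  have hvol : (volume : Measure Circ).real Set.univ = 2 * π := by
    rw [Measure.real, AddCircle.measure_univ, ENNReal.toReal_ofReal Real.two_pi_pos.le]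
  have hI : π * r ≤ ∫ φ, h φ := by
    have h1 : ∫ φ : Circ, r ≤ ∫ φ, (h φ + h (φ + (π : ℝ))) := by
      apply integral_mono (integrable_const _)
      · exact hint _ (by fun_prop)
      · intro φ; exact (hsup_props hS hr hdiam φ).1
    rw [integral_add (hint _ hcont) (hint _ (by fun_prop)), hshift, integral_const, hvol,
      smul_eq_mul] at h1
    linarith
  -- the main inequality, for each small `ε`
  have main : ∀ ε : ℝ, 0 < ε → ε < π → ∑ x ∈ X, 2 * (η x - ε) ≤ π := by
    intro ε hε hεπ
    have hcosε : Real.cos ε < 1 := by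
      rw [← Real.cos_zero]
      exact Real.cos_lt_cos_of_nonneg_of_le_pi le_rfl hεπ.le hε
    set G : Set Circ := ⋃ x ∈ X, closedBall (θ x : Circ) (η x - ε) with hG
    have hGm : MeasurableSet G := Finset.measurableSet_biUnion _ fun x _ => measurableSet_closedBall
    have hGvol : ∑ x ∈ X, 2 * (η x - ε) ≤ volume.real G := by
      rw [hG, measureReal_biUnion_finset]
      · apply Finset.sum_le_sum
        intro x hx
        rw [Measure.real, AddCircle.volume_closedBall, min_eq_right (by linarith [(hη x hx).2, Real.pi_pos])]
        rw [ENNReal.toReal_ofReal']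
        exact le_max_left _ _
      · intro x hx y hy hxy
        exact (hdisj x hx y hy hxy).mono (closedBall_subset_closedBall (by linarith))
          (closedBall_subset_closedBall (by linarith))
      · intro x _; exact measurableSet_closedBall
    have hptw : ∀ φ, h (φ + (ε : ℝ)) + h (φ + ((-ε : ℝ) : Circ)) - 2 * Real.cos ε * h φ
        ≤ Gᶜ.indicator (fun _ => 2 * r * (1 - Real.cos ε)) φ := by
      intro φ
      by_cases hφ : φ ∈ G
      · rw [Set.indicator_of_notMem (by simpa using hφ)]
        simp only [hG, Set.mem_iUnion, exists_prop] at hφ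
        obtain ⟨x, hx, hφ⟩ := hφ
        obtain ⟨t, ht, rfl⟩ := circ_dist_le hφ
        have hle : ∀ s, |s| ≤ η x → h ((θ x + s : ℝ) : Circ) ≤ ipr (p x) (θ x + s) := by
          intro s hs
          obtain ⟨y, hy, hy1, -⟩ := hsup_attain hT hne ((θ x + s : ℝ) : Circ)
          rw [hh, ← hy1, iprC_coe]
          exact hsupp x hx y hy s hs
        obtain ⟨ht1, ht2⟩ := abs_le.1 ht
        have h1 := hle (t + ε) (abs_le.2 ⟨by linarith, by linarith⟩)
        have h2 := hle (t - ε) (abs_le.2 ⟨by linarith, by linarith⟩)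
        have h3 := ipr_shift (p x) (θ x + t) ε
        have h4 := hsup_ge hT (hp x hx) ((θ x + t : ℝ) : Circ)
        have h5 := hle t (abs_le.2 ⟨by linarith, by linarith⟩)
        rw [iprC_coe, ← hh] at h4
        have h6 : h ((θ x + t : ℝ) : Circ) = ipr (p x) (θ x + t) := le_antisymm h5 h4
        rw [← AddCircle.coe_add, ← AddCircle.coe_add, h6, ← h3, ← sub_eq_add_neg]
        rw [show θ x + t + ε = θ x + (t + ε) by ring, show θ x + t - ε = θ x + (t - ε) by ring]
        linarith
      · rw [Set.indicator_of_mem (by simpa using hφ)]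
        have := (hsup_props hS hr hdiam φ).2 ε
        linarith
    have hint2 : ∫ φ, (h (φ + (ε : ℝ)) + h (φ + ((-ε : ℝ) : Circ)) - 2 * Real.cos ε * h φ)
        ≤ ∫ φ, Gᶜ.indicator (fun _ => 2 * r * (1 - Real.cos ε)) φ := by
      apply integral_mono
      · exact hint _ (by fun_prop)
      · exact (integrable_const _).indicator hGm.compl
      · exact hptw
    rw [integral_sub (hint _ (by fun_prop)) (hint _ (by fun_prop)),
      integral_add (hint _ (by fun_prop)) (hint _ (by fun_prop)), hshift, hshift,
      integral_const_mul, integral_indicator hGm.compl, setIntegral_const, smul_eq_mul,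
      measureReal_compl hGm, hvol] at hint2
    have hpos : 0 < 1 - Real.cos ε := by linarith
    have h7 : (1 - Real.cos ε) * (2 * ∫ φ, h φ)
      ≤ (1 - Real.cos ε) * (2 * (r * (2 * π - volume.real G))) := by linarith
    have h8 := le_of_mul_le_mul_left h7 hpos
    have h9 : r * volume.real G ≤ r * π := by linarith
    exact hGvol.trans (le_of_mul_le_mul_left h9 hr)
  -- let `ε → 0`
  have hlim : Filter.Tendsto (fun ε : ℝ => ∑ x ∈ X, 2 * (η x - ε)) (nhdsWithin 0 (Set.Ioi 0))
      (nhds (∑ x ∈ X, 2 * (η x - 0))) := by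
    apply Filter.Tendsto.mono_left _ nhdsWithin_le_nhds
    apply Continuous.tendsto
    fun_prop
  simp only [sub_zero] at hlim
  apply le_of_tendsto hlim
  have : Set.Ioo (0 : ℝ) π ∈ nhdsWithin (0 : ℝ) (Set.Ioi 0) := Ioo_mem_nhdsGT Real.pi_pos
  filter_upwards [this] with ε hε
  exact main ε hε.1 hε.2

lemma arcsin_convex {d : ℝ} (hd1 : 1 ≤ d) (hd2 : d < 2) :
    ConvexOn ℝ (Set.Icc 0 (π / 6)) (fun η => Real.arcsin (d * Real.sin η)) := by
  have hpi := Real.pi_pos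
  have hbd : ∀ η ∈ Set.Ioo (0 : ℝ) (π / 6), 0 < Real.sin η ∧ d * Real.sin η < 1 := by
    intro η hη
    have h1 : Real.sin η < 1 / 2 := by
      rw [← Real.sin_pi_div_six]
      exact Real.sin_lt_sin_of_lt_of_le_pi_div_two (by linarith [hη.1]) (by linarith) hη.2
    have h0 : 0 < Real.sin η := Real.sin_pos_of_pos_of_lt_pi hη.1 (by linarith [hη.2])
    exact ⟨h0, by nlinarith⟩
  have hder : ∀ η ∈ Set.Ioo (0 : ℝ) (π / 6), HasDerivAt (fun η => Real.arcsin (d * Real.sin η))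
      (1 / Real.sqrt (1 - (d * Real.sin η) ^ 2) * (d * Real.cos η)) η := by
    intro η hη
    obtain ⟨h0, h1⟩ := hbd η hη
    have hd0 : 0 < d * Real.sin η := by positivity
    have := (Real.hasDerivAt_arcsin (x := d * Real.sin η) (by linarith) (by linarith)).comp η
      ((Real.hasDerivAt_sin η).const_mul d)
    exact this
  apply MonotoneOn.convexOn_of_deriv (convex_Icc _ _)
  · apply Continuous.continuousOn
    exact Real.continuous_arcsin.comp (by fun_prop)
  · rw [interior_Icc]
    intro η hη
    exact (hder η hη).differentiableAt.differentiableWithinAt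
  · rw [interior_Icc]
    intro a ha b hb hab
    rw [(hder a ha).deriv, (hder b hb).deriv]
    obtain ⟨a0, a1⟩ := hbd a ha
    obtain ⟨b0, b1⟩ := hbd b hb
    have hsab : Real.sin a ≤ Real.sin b :=
      Real.sin_le_sin_of_le_of_le_pi_div_two (by linarith [ha.1]) (by linarith [hb.2]) hab
    have ca : 0 < Real.cos a := Real.cos_pos_of_mem_Ioo ⟨by linarith [ha.1], by linarith [ha.2]⟩
    have cb : 0 < Real.cos b := Real.cos_pos_of_mem_Ioo ⟨by linarith [hb.1], by linarith [hb.2]⟩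
    have pa := Real.sin_sq_add_cos_sq a
    have pb := Real.sin_sq_add_cos_sq b
    have hA : 0 < 1 - (d * Real.sin a) ^ 2 := by
      have : 0 < d * Real.sin a := by positivity
      nlinarith
    have hB : 0 < 1 - (d * Real.sin b) ^ 2 := by
      have : 0 < d * Real.sin b := by positivity
      nlinarith
    rw [one_div_mul_eq_div, one_div_mul_eq_div, div_le_div_iff₀ (Real.sqrt_pos.2 hA) (Real.sqrt_pos.2 hB)]
    apply le_of_sq_le_sq _ (by positivity)
    rw [mul_pow, mul_pow (d * Real.cos b), Real.sq_sqrt hA.le, Real.sq_sqrt hB.le]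
    have ca2 : Real.cos a ^ 2 = 1 - Real.sin a ^ 2 := by linarith
    have cb2 : Real.cos b ^ 2 = 1 - Real.sin b ^ 2 := by linarith
    rw [mul_pow, mul_pow, mul_pow, mul_pow, ca2, cb2]
    have hs2 : Real.sin a ^ 2 ≤ Real.sin b ^ 2 := by gcongr
    have hdd : 0 ≤ d ^ 2 * (d ^ 2 - 1) := by
      apply mul_nonneg (by positivity); nlinarith
    nlinarith [mul_nonneg hdd (sub_nonneg.2 hs2)]

lemma arcsin_bound {d η : ℝ} (hd1 : 1 ≤ d) (hd2 : d < 2) (h0 : 0 ≤ η) (h1 : η ≤ π / 6) :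
    Real.arcsin (d * Real.sin η) ≤ 6 * Real.arcsin (d / 2) / π * η := by
  have hpi := Real.pi_pos
  have hc := (arcsin_convex hd1 hd2).2 (show (0 : ℝ) ∈ Set.Icc 0 (π / 6) from ⟨le_rfl, by positivity⟩)
    (show π / 6 ∈ Set.Icc 0 (π / 6) from ⟨by positivity, le_rfl⟩)
    (show 0 ≤ 1 - η / (π / 6) by rw [sub_nonneg, div_le_one (by positivity)]; exact h1)
    (show 0 ≤ η / (π / 6) by positivity) (by ring)
  simp only [smul_eq_mul, mul_zero, zero_add, Real.sin_zero, Real.arcsin_zero,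
    Real.sin_pi_div_six] at hc
  rw [div_mul_cancel₀ _ (by positivity)] at hc
  refine hc.trans (le_of_eq ?_)
  rw [mul_one_div]
  field_simp

lemma Qn_uvec (t : ℝ) : Qn (uvec t) = 1 := by
  simp [Qn, uvec]

lemma uvec_eq_exp (t : ℝ) : uvec t = Complex.exp (t * Complex.I) := by
  apply Complex.ext
  · rw [Complex.exp_ofReal_mul_I_re]; rfl
  · rw [Complex.exp_ofReal_mul_I_im]; rfl

lemma perturb {S : Finset ℂ} {x : ℂ} {α : ℝ} (hx : x ∈ capB S 1)
    (hact : ∀ c ∈ S, Qn (x - c) = 1 → ipr (x - c) α < 0) :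
    ∃ ε : ℝ, 0 < ε ∧ x + ε * uvec α ∈ capB S 1 := by
  have h : ∀ᶠ ε : ℝ in nhdsWithin 0 (Set.Ioi 0), ∀ c ∈ S, Qn (x + ε * uvec α - c) ≤ 1 ^ 2 := by
    rw [Filter.eventually_all_finset]
    intro c hc
    have e : ∀ ε : ℝ, Qn (x + ε * uvec α - c) = Qn (x - c) + 2 * ε * ipr (x - c) α + ε ^ 2 := by
      intro ε
      rw [← Qn_add_smul]; congr 1; ring
    have hle := hx c hc
    rcases hle.lt_or_eq with hlt | heq
    · have hcont : Continuous fun ε : ℝ => Qn (x - c) + 2 * ε * ipr (x - c) α + ε ^ 2 := by fun_prop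
      have h0 := hcont.tendsto 0
      have : ∀ᶠ ε : ℝ in nhds 0, Qn (x - c) + 2 * ε * ipr (x - c) α + ε ^ 2 < 1 ^ 2 :=
        h0.eventually (gt_mem_nhds (by simpa using hlt))
      filter_upwards [nhdsWithin_le_nhds this] with ε hε
      rw [e]; exact hε.le
    · have hneg := hact c hc (by simpa using heq)
      have : Set.Ioo (0 : ℝ) (-2 * ipr (x - c) α) ∈ nhdsWithin (0 : ℝ) (Set.Ioi 0) :=
        Ioo_mem_nhdsGT (by linarith)
      filter_upwards [this] with ε hε
      rw [e, heq]
      nlinarith [hε.1, hε.2]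
  obtain ⟨ε, hε, hε0⟩ := (h.and self_mem_nhdsWithin).exists
  exact ⟨ε, hε0, hε⟩

lemma kkt {S : Finset ℂ} {x y0 : ℂ} (hy0 : ∀ c ∈ S, Qn (y0 - c) < 1) (hx : x ∈ capB S 1)
    (hact : ∃ c ∈ S, Qn (x - c) = 1) :
    ∃ θ ω : ℝ, 0 ≤ ω ∧ ω < π / 2 ∧ x - uvec (θ - ω) ∈ S ∧ x - uvec (θ + ω) ∈ S ∧
      ∀ φ : Circ, (∀ y ∈ capB S 1, iprC y φ ≤ iprC x φ) → φ ∈ closedBall (θ : Circ) ω := by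
  classical
  set w := x - y0 with hw
  set A := S.filter (fun c => Qn (x - c) = 1) with hA
  have hAne : A.Nonempty := by
    obtain ⟨c, hc, h⟩ := hact
    exact ⟨c, by simp [hA, hc, h]⟩
  have hre : ∀ c ∈ A, 0 < (x - c).re * w.re + (x - c).im * w.im := by
    intro c hc
    obtain ⟨hcS, h1⟩ := Finset.mem_filter.1 hc
    have h2 := hy0 c hcS
    have e : Qn (y0 - c) = Qn (x - c) - 2 * ((x - c).re * w.re + (x - c).im * w.im) + Qn w := by
      simp [Qn, hw]; ring
    have := Qn_nonneg w
    linarith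
  have hw0 : w ≠ 0 := by
    intro h0
    obtain ⟨c, hc⟩ := hAne
    have := hre c hc
    rw [h0] at this
    simp at this
  have hQw : 0 < Complex.normSq w := Complex.normSq_pos.2 hw0
  set β : ℂ → ℝ := fun c => Complex.arg ((x - c) / w) with hβ
  have hβ1 : ∀ c ∈ A, |β c| < π / 2 := by
    intro c hc
    rw [hβ, Complex.abs_arg_lt_pi_div_two_iff]
    left
    rw [Complex.div_re, ← add_div]
    exact div_pos (hre c hc) hQw
  have hβ2 : ∀ c ∈ A, x - c = uvec (Complex.arg w + β c) := by
    intro c hc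
    obtain ⟨hcS, h1⟩ := Finset.mem_filter.1 hc
    have hn : ‖x - c‖ = 1 := by
      rw [Qn_eq] at h1
      exact (pow_eq_one_iff_of_nonneg (norm_nonneg _) two_ne_zero).1 h1
    have h2 := Complex.norm_mul_exp_arg_mul_I w
    have h3 := Complex.norm_mul_exp_arg_mul_I ((x - c) / w)
    have hnw : ‖w‖ ≠ 0 := norm_ne_zero_iff.2 hw0
    rw [uvec_eq_exp, Complex.ofReal_add, add_mul, Complex.exp_add]
    rw [norm_div, hn] at h3
    have h4 : x - c = ((x - c) / w) * w := by field_simp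
    rw [h4, ← h3]
    nth_rewrite 3 [← h2]
    have : (‖w‖ : ℂ) ≠ 0 := by exact_mod_cast hnw
    simp only [hβ]
    push_cast
    field_simp
  obtain ⟨c1, hc1, hmin⟩ := Finset.exists_min_image A β hAne
  obtain ⟨c2, hc2, hmax⟩ := Finset.exists_max_image A β hAne
  have b1 := abs_lt.1 (hβ1 c1 hc1)
  have b2 := abs_lt.1 (hβ1 c2 hc2)
  have b12 := hmin c2 hc2
  set θ := Complex.arg w + (β c1 + β c2) / 2 with hθ
  set ω := (β c2 - β c1) / 2 with hω
  have hω0 : 0 ≤ ω := by rw [hω]; linarith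
  have hω1 : ω < π / 2 := by rw [hω]; linarith
  refine ⟨θ, ω, hω0, hω1, ?_, ?_, ?_⟩
  · rw [show θ - ω = Complex.arg w + β c1 by rw [hθ, hω]; ring, ← hβ2 c1 hc1, sub_sub_cancel]
    exact (Finset.mem_filter.1 hc1).1
  · rw [show θ + ω = Complex.arg w + β c2 by rw [hθ, hω]; ring, ← hβ2 c2 hc2, sub_sub_cancel]
    exact (Finset.mem_filter.1 hc2).1
  intro φ hφ
  have hball : φ ∈ closedBall (θ : Circ) π := by
    rw [AddCircle.closedBall_eq_univ_of_half_period_le _ Real.two_pi_pos.ne']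
    · trivial
    · rw [abs_of_pos Real.two_pi_pos]; linarith
  obtain ⟨t, ht, rfl⟩ := circ_dist_le hball
  apply circ_mem_of
  have hdir : ∀ α : ℝ, (∀ b : ℝ, |b| ≤ ω → Real.cos (θ + b - α) < 0) →
      Real.cos (α - (θ + t)) ≤ 0 := by
    intro α hα
    obtain ⟨ε, hε, hmem⟩ := perturb (α := α) hx (by
      intro c hc h1
      have hcA : c ∈ A := Finset.mem_filter.2 ⟨hc, h1⟩
      rw [hβ2 c hcA, ipr_uvec]
      have := hα (β c - (β c1 + β c2) / 2) (by
        have := hmin c hcA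
        have := hmax c hcA
        rw [abs_le, hω]; constructor <;> linarith)
      convert this using 2
      rw [hθ]; ring)
    have := hφ _ hmem
    rw [iprC_coe, iprC_coe, ipr_add, ipr_smul, ipr_uvec] at this
    by_contra hcon
    push Not at hcon
    nlinarith
  by_contra hcon
  push Not at hcon
  obtain ⟨ht1, ht2⟩ := abs_le.1 ht
  rcases lt_abs.1 hcon with htp | htn
  · obtain ⟨κ, hκ0, hκ⟩ := exists_between (show 0 < min (π - 2 * ω) (t - ω) by
      apply lt_min <;> linarith)
    have k1 := hκ.trans_le (min_le_left _ _)
    have k2 := hκ.trans_le (min_le_right _ _)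
    have := hdir (θ + ω + π / 2 + κ) (by
      intro b hb
      obtain ⟨hb1, hb2⟩ := abs_le.1 hb
      rw [show θ + b - (θ + ω + π / 2 + κ) = -((ω - b + κ) + π / 2) by ring, Real.cos_neg,
        Real.cos_add_pi_div_two]
      have := Real.sin_pos_of_pos_of_lt_pi (x := ω - b + κ) (by linarith) (by linarith)
      linarith)
    rw [show θ + ω + π / 2 + κ - (θ + t) = π / 2 - (t - ω - κ) by ring,
      Real.cos_pi_div_two_sub] at this
    have h2 := Real.sin_pos_of_pos_of_lt_pi (x := t - ω - κ) (by linarith) (by linarith)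
    linarith
  · obtain ⟨κ, hκ0, hκ⟩ := exists_between (show 0 < min (π - 2 * ω) (-t - ω) by
      apply lt_min <;> linarith)
    have k1 := hκ.trans_le (min_le_left _ _)
    have k2 := hκ.trans_le (min_le_right _ _)
    have := hdir (θ - ω - π / 2 - κ) (by
      intro b hb
      obtain ⟨hb1, hb2⟩ := abs_le.1 hb
      rw [show θ + b - (θ - ω - π / 2 - κ) = (ω + b + κ) + π / 2 by ring,
        Real.cos_add_pi_div_two]
      have := Real.sin_pos_of_pos_of_lt_pi (x := ω + b + κ) (by linarith) (by linarith)
      linarith)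
    rw [show θ - ω - π / 2 - κ - (θ + t) = -(π / 2 - (-t - ω - κ)) by ring, Real.cos_neg,
      Real.cos_pi_div_two_sub] at this
    have h2 := Real.sin_pos_of_pos_of_lt_pi (x := -t - ω - κ) (by linarith) (by linarith)
    linarith

/-- Unit vector on the circle. -/
def uC (φ : Circ) : ℂ := ⟨cosC φ, sinC φ⟩

@[simp] lemma uC_coe (t : ℝ) : uC (t : Circ) = uvec t := rfl

/-- Directions in which a center sees the boundary of the disk-polygon. -/
def Nset (S : Finset ℂ) : Set Circ := {φ | ∃ c ∈ S, c + uC φ ∈ capB S 1}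

/-- Vertex reconstruction from two centers. -/
def vtx (c1 c2 : ℂ) : ℂ :=
  (c1 + c2) / 2 + (Real.sqrt (1 - Qn (c1 - c2) / 4) : ℝ) *
    ((c1 - c2) / (Complex.I * (Real.sqrt (Qn (c1 - c2)) : ℝ)))

lemma chord_eq (x : ℂ) (θ ω : ℝ) :
    (x - uvec (θ - ω)) - (x - uvec (θ + ω)) = (2 * Real.sin ω : ℝ) * (Complex.I * uvec θ) := by
  apply Complex.ext
  · simp [uvec, Real.cos_sub, Real.cos_add, -Complex.ofReal_sin, -Complex.ofReal_cos]; ring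
  · simp [uvec, Real.sin_sub, Real.sin_add, -Complex.ofReal_sin, -Complex.ofReal_cos]; ring

lemma Qn_chord (x : ℂ) (θ ω : ℝ) :
    Qn ((x - uvec (θ - ω)) - (x - uvec (θ + ω))) = (2 * Real.sin ω) ^ 2 := by
  rw [chord_eq]
  have := Real.sin_sq_add_cos_sq θ
  simp [Qn, uvec, -Complex.ofReal_sin, -Complex.ofReal_cos]
  linear_combination (4 * Real.sin ω ^ 2) * this

lemma vtx_eq {x : ℂ} {θ ω : ℝ} (h0 : 0 < ω) (h1 : ω < π / 2) :
    vtx (x - uvec (θ - ω)) (x - uvec (θ + ω)) = x := by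
  have hs : 0 < Real.sin ω := Real.sin_pos_of_pos_of_lt_pi h0 (by linarith [Real.pi_pos])
  have hc : 0 < Real.cos ω := Real.cos_pos_of_mem_Ioo ⟨by linarith [Real.pi_pos], h1⟩
  unfold vtx
  rw [Qn_chord, chord_eq, Real.sqrt_sq (by positivity)]
  have e : 1 - (2 * Real.sin ω) ^ 2 / 4 = Real.cos ω ^ 2 := by
    have := Real.sin_sq_add_cos_sq ω
    linear_combination -this
  rw [e, Real.sqrt_sq hc.le]
  have e2 : ((2 * Real.sin ω : ℝ) : ℂ) * (Complex.I * uvec θ) /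
      (Complex.I * ((2 * Real.sin ω : ℝ) : ℂ)) = uvec θ := by
    have : ((2 * Real.sin ω : ℝ) : ℂ) ≠ 0 := by
      exact_mod_cast (by positivity : (2 * Real.sin ω : ℝ) ≠ 0)
    have := Complex.I_ne_zero
    field_simp
  rw [e2]
  apply Complex.ext
  · simp [uvec, Real.cos_sub, Real.cos_add, -Complex.ofReal_sin, -Complex.ofReal_cos]; ring
  · simp [uvec, Real.sin_sub, Real.sin_add, -Complex.ofReal_sin, -Complex.ofReal_cos]; ring

/-- Vertex data. -/
def VD (S : Finset ℂ) (x : ℂ) (θ ω : ℝ) : Prop :=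
  0 < ω ∧ ω < π / 2 ∧ x - uvec (θ - ω) ∈ S ∧ x - uvec (θ + ω) ∈ S ∧
      ∀ φ : Circ, (∀ y ∈ capB S 1, iprC y φ ≤ iprC x φ) → φ ∈ closedBall (θ : Circ) ω

lemma cover_lemma {S : Finset ℂ} (hS : S.Nonempty) {y0 : ℂ} (hy0 : ∀ c ∈ S, Qn (y0 - c) < 1)
    (φ : Circ) : φ ∈ Nset S ∨ ∃ x ∈ capB S 1, (∃ θ ω, VD S x θ ω) ∧
      ∀ θ ω, VD S x θ ω → φ ∈ closedBall (θ : Circ) ω := by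
  have hne : (capB S 1).Nonempty := ⟨y0, fun c hc => by simpa using (hy0 c hc).le⟩
  obtain ⟨x, hx, -, hmax⟩ := hsup_attain (capB_compact hS zero_le_one) hne φ
  have hact : ∃ c ∈ S, Qn (x - c) = 1 := by
    by_contra hcon
    push Not at hcon
    obtain ⟨t, rfl⟩ := circ_rep φ
    obtain ⟨ε, hε, hmem⟩ := perturb (α := t) hx (fun c hc h => absurd h (hcon c hc))
    have := hmax _ hmem
    rw [iprC_coe, iprC_coe, ipr_add, ipr_smul, ipr_uvec, sub_self, Real.cos_zero] at this
    linarith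
  obtain ⟨θ, ω, h0, h1, hc1, hc2, hb⟩ := kkt hy0 hx hact
  rcases h0.eq_or_lt with h0 | h0
  · left
    have := hb φ hmax
    rw [← h0] at this
    rw [closedBall_zero, Set.mem_singleton_iff] at this
    refine ⟨_, hc1, ?_⟩
    rw [this, uC_coe, ← h0, sub_zero, sub_add_cancel]
    exact hx
  · right
    refine ⟨x, hx, ⟨θ, ω, h0, h1, hc1, hc2, hb⟩, ?_⟩
    intro θ' ω' h
    exact h.2.2.2.2 φ hmax

lemma main_min {S : Finset ℂ} (hS : S.Nonempty) {d : ℝ} (hd1 : 1 ≤ d) (hd2 : d < 2)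
    (hdiam : ∀ c ∈ S, ∀ c' ∈ S, Qn (c - c') ≤ d ^ 2)
    {y0 : ℂ} (hy0 : ∀ c ∈ S, Qn (y0 - c) < 1)
    (hMin : ∀ c ∈ S, ∃ y, 1 ≤ Qn (y - c) ∧ ∀ c' ∈ S, c' ≠ c → Qn (y - c') < 1) :
    ENNReal.ofReal (2 * π - 6 * Real.arcsin (d / 2)) ≤ volume (Nset S) := by
  classical
  have hpi := Real.pi_pos
  set X : Finset ℂ := ((S ×ˢ S).image (fun q => vtx q.1 q.2)).filter
    (fun x => x ∈ capB S 1 ∧ ∃ θ ω, VD S x θ ω) with hX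
  have hXmem : ∀ x, x ∈ X ↔ x ∈ capB S 1 ∧ ∃ θ ω, VD S x θ ω := by
    intro x
    rw [hX, Finset.mem_filter]
    refine ⟨fun h => h.2, fun h => ⟨?_, h⟩⟩
    obtain ⟨-, θ, ω, h0, h1, h2, h3, -⟩ := h
    exact Finset.mem_image.2 ⟨(_, _), Finset.mem_product.2 ⟨h2, h3⟩, vtx_eq h0 h1⟩
  have hex : ∀ x, ∃ θ ω, x ∈ X → VD S x θ ω := by
    intro x
    by_cases h : x ∈ X
    · obtain ⟨θ, ω, h'⟩ := ((hXmem x).1 h).2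
      exact ⟨θ, ω, fun _ => h'⟩
    · exact ⟨0, 0, fun h' => absurd h' h⟩
  choose θ ω hVD using hex
  -- covering
  have hcov : (Set.univ : Set Circ) ⊆ Nset S ∪ ⋃ x ∈ X, closedBall (θ x : Circ) (ω x) := by
    intro φ _
    rcases cover_lemma hS hy0 φ with h | ⟨x, hx, hx1, hx2⟩
    · exact Or.inl h
    · right
      have hxX : x ∈ X := (hXmem x).2 ⟨hx, hx1⟩
      exact Set.mem_biUnion hxX (hx2 _ _ (hVD x hxX))
  have hvol : ENNReal.ofReal (2 * π) ≤ volume (Nset S) + ENNReal.ofReal (∑ x ∈ X, 2 * ω x) := by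
    calc ENNReal.ofReal (2 * π) = volume (Set.univ : Set Circ) := (AddCircle.measure_univ _).symm
      _ ≤ volume (Nset S ∪ ⋃ x ∈ X, closedBall (θ x : Circ) (ω x)) := measure_mono hcov
      _ ≤ volume (Nset S) + volume (⋃ x ∈ X, closedBall (θ x : Circ) (ω x)) := measure_union_le _ _
      _ ≤ volume (Nset S) + ∑ x ∈ X, volume (closedBall (θ x : Circ) (ω x)) := by
          gcongr; exact measure_biUnion_finset_le _ _
      _ ≤ volume (Nset S) + ∑ x ∈ X, ENNReal.ofReal (2 * ω x) := by
          gcongr with x hx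
          rw [AddCircle.volume_closedBall]
          exact ENNReal.ofReal_le_ofReal (min_le_right _ _)
      _ = _ := by
          rw [ENNReal.ofReal_sum_of_nonneg]
          intro x hx
          have := (hVD x hx).1
          positivity
  set η : ℂ → ℝ := fun x => Real.arcsin (Real.sin (ω x) / d) with hηdef
  have hd0 : 0 < d := by linarith
  have hsin : ∀ x ∈ X, 0 < Real.sin (ω x) ∧ Real.sin (ω x) ≤ d / 2 := by
    intro x hx
    obtain ⟨h0, h1, h2, h3, -⟩ := hVD x hx
    have hs : 0 < Real.sin (ω x) := Real.sin_pos_of_pos_of_lt_pi h0 (by linarith)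
    refine ⟨hs, ?_⟩
    have := hdiam _ h2 _ h3
    rw [Qn_chord] at this
    have := le_of_sq_le_sq this hd0.le
    linarith
  have hη : ∀ x ∈ X, 0 < η x ∧ η x ≤ π / 6 ∧ d * Real.sin (η x) = Real.sin (ω x) ∧ η x ≤ ω x := by
    intro x hx
    obtain ⟨h0, h1, -⟩ := hVD x hx
    obtain ⟨s0, s1⟩ := hsin x hx
    have hle : Real.sin (ω x) / d ≤ 1 / 2 := by rw [div_le_iff₀ hd0]; linarith
    have hle' : Real.sin (ω x) / d ≤ Real.sin (ω x) := div_le_self s0.le hd1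
    have hp : 0 < Real.sin (ω x) / d := by positivity
    refine ⟨Real.arcsin_pos.2 hp, ?_, ?_, ?_⟩
    · rw [Real.arcsin_le_iff_le_sin' ⟨by linarith, by linarith⟩, Real.sin_pi_div_six]
      exact hle
    · rw [hηdef]; dsimp only
      rw [Real.sin_arcsin (by linarith) (by linarith)]
      field_simp
    · rw [Real.arcsin_le_iff_le_sin' ⟨by linarith, by linarith⟩]
      exact hle'
  set p : ℂ → ℂ := fun x => x + (d * Real.cos (η x) - Real.cos (ω x) : ℝ) * uvec (θ x) with hp
  have hp1 : ∀ x ∈ X, x - uvec (θ x - ω x) = p x - d * uvec (θ x - η x) := by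
    intro x hx
    have h := (hη x hx).2.2.1
    apply Complex.ext
    · simp [hp, uvec, Real.cos_sub, -Complex.ofReal_sin, -Complex.ofReal_cos]
      linear_combination (Real.sin (θ x)) * h
    · simp [hp, uvec, Real.sin_sub, -Complex.ofReal_sin, -Complex.ofReal_cos]
      linear_combination (-Real.cos (θ x)) * h
  have hp2 : ∀ x ∈ X, x - uvec (θ x + ω x) = p x - d * uvec (θ x + η x) := by
    intro x hx
    have h := (hη x hx).2.2.1
    apply Complex.ext
    · simp [hp, uvec, Real.cos_add, -Complex.ofReal_sin, -Complex.ofReal_cos]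
      linear_combination (-Real.sin (θ x)) * h
    · simp [hp, uvec, Real.sin_add, -Complex.ofReal_sin, -Complex.ofReal_cos]
      linear_combination (Real.cos (θ x)) * h
  have hQd : ∀ t : ℝ, Qn (d * uvec t) = d ^ 2 := by
    intro t
    have := Real.sin_sq_add_cos_sq t
    simp [Qn, uvec, -Complex.ofReal_sin, -Complex.ofReal_cos]
    linear_combination (d ^ 2) * this
  have hcb := cauchy_bound hS hd0 hdiam X θ η p
    (fun x hx => ⟨(hη x hx).1, by linarith [(hη x hx).2.1]⟩)
    (by
      intro x hx c hc
      obtain ⟨h0, h1, h2, h3, -⟩ := hVD x hx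
      by_cases e1 : c = x - uvec (θ x - ω x)
      · rw [e1, hp1 x hx, sub_sub_cancel, hQd]
      by_cases e2 : c = x - uvec (θ x + ω x)
      · rw [e2, hp2 x hx, sub_sub_cancel, hQd]
      by_contra hcon
      push Not at hcon
      obtain ⟨y, hy, hy'⟩ := hMin c hc
      obtain ⟨g1, g2, g3, g4⟩ := hη x hx
      have := lens_lemma (y := y) hd1 rfl rfl h0 h1 g1 (by linarith) g3 rfl
        (by simpa using ((hXmem x).1 hx).1 c hc) hcon
        (hy' _ h2 (fun h => e1 h.symm)) (hy' _ h3 (fun h => e2 h.symm))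
      linarith)
    (by
      intro x hx y hy t ht
      obtain ⟨h0, h1, h2, h3, -⟩ := hVD x hx
      obtain ⟨g1, g2, g3, g4⟩ := hη x hx
      have := cone_lemma (hp1 x hx) (hp2 x hx) (hy _ h2) (hy _ h3) g1 (by linarith) ht
      rw [ipr_sub] at this
      have := Qn_nonneg (y - p x)
      nlinarith)
    (by
      intro x hx y hy hxy
      rw [Set.disjoint_left]
      intro φ hφ1 hφ2
      have key : ∀ x ∈ X, ∀ y ∈ X, x ≠ y → φ ∈ closedBall (θ x : Circ) (η x) →
          iprC y φ < iprC x φ := by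
        intro x hx y hy hxy hφ
        obtain ⟨t, ht, rfl⟩ := circ_dist_le hφ
        obtain ⟨h0, h1, h2, h3, -⟩ := hVD x hx
        have hyc := ((hXmem y).1 hy).1
        have := cone_lemma (q := x) (r := 1) (y := y) (θ := θ x) (ω := ω x) (t := t)
          (by rw [Complex.ofReal_one, one_mul]) (by rw [Complex.ofReal_one, one_mul])
          (hyc _ h2) (hyc _ h3) h0 h1 (ht.trans (hη x hx).2.2.2)
        rw [ipr_sub] at this
        have := Qn_pos (sub_ne_zero.2 hxy.symm)
        rw [iprC_coe, iprC_coe]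
        linarith
      have := key x hx y hy hxy hφ1
      have := key y hy x hx hxy.symm hφ2
      linarith)
  have hsum : ∑ x ∈ X, 2 * ω x ≤ 6 * Real.arcsin (d / 2) := by
    have ha : 0 ≤ Real.arcsin (d / 2) := Real.arcsin_nonneg.2 (by positivity)
    calc ∑ x ∈ X, 2 * ω x ≤ ∑ x ∈ X, 6 * Real.arcsin (d / 2) / π * (2 * η x) := by
          apply Finset.sum_le_sum
          intro x hx
          obtain ⟨g1, g2, g3, g4⟩ := hη x hx
          obtain ⟨h0, h1, -⟩ := hVD x hx
          have := arcsin_bound hd1 hd2 g1.le g2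
          rw [g3, Real.arcsin_sin (by linarith) (by linarith)] at this
          linarith
      _ = 6 * Real.arcsin (d / 2) / π * ∑ x ∈ X, 2 * η x := by rw [Finset.mul_sum]
      _ ≤ 6 * Real.arcsin (d / 2) / π * π := by gcongr
      _ = _ := by field_simp
  rw [ENNReal.ofReal_sub _ (by have := Real.arcsin_nonneg.2 (by positivity : 0 ≤ d / 2); positivity)]
  rw [tsub_le_iff_right]
  exact hvol.trans (by gcongr)

lemma Qn_comb (a b : ℂ) (t : ℝ) (h0 : 0 ≤ t) (h1 : t ≤ 1) :
    Qn ((1 - t : ℝ) * a + (t : ℝ) * b) ≤ (1 - t) * Qn a + t * Qn b := by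
  have e : Qn ((1 - t : ℝ) * a + (t : ℝ) * b) =
      (1 - t) * Qn a + t * Qn b - t * (1 - t) * Qn (a - b) := by
    simp [Qn]; ring
  rw [e]
  have := Qn_nonneg (a - b)
  have : 0 ≤ t * (1 - t) := mul_nonneg h0 (by linarith)
  nlinarith [mul_nonneg this (Qn_nonneg (a - b))]

lemma main_lemma {d : ℝ} (hd1 : 1 ≤ d) (hd2 : d < 2) {y0 : ℂ} (S : Finset ℂ) :
    S.Nonempty → (∀ c ∈ S, ∀ c' ∈ S, Qn (c - c') ≤ d ^ 2) → (∀ c ∈ S, Qn (y0 - c) < 1) →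
    ENNReal.ofReal (2 * π - 6 * Real.arcsin (d / 2)) ≤ volume (Nset S) := by
  induction S using Finset.strongInduction with
  | H S ih =>
    intro hS hdiam hy0
    by_cases hMin : ∀ c ∈ S, ∃ y, 1 ≤ Qn (y - c) ∧ ∀ c' ∈ S, c' ≠ c → Qn (y - c') < 1
    · exact main_min hS hd1 hd2 hdiam hy0 hMin
    push Not at hMin
    obtain ⟨c, hc, hcm⟩ := hMin
    have hne : (S.erase c).Nonempty := by
      by_contra hcon
      rw [Finset.not_nonempty_iff_eq_empty] at hcon
      obtain ⟨c', hc', hcc, -⟩ := hcm (c + 1) (by simp [Qn])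
      have : c' ∈ S.erase c := Finset.mem_erase.2 ⟨hcc, hc'⟩
      rw [hcon] at this
      simp at this
    have hsub : ∀ c' ∈ S.erase c, c' ∈ S := fun c' h => Finset.mem_of_mem_erase h
    have hcap : capB (S.erase c) 1 ⊆ capB S 1 := by
      intro y hy c' hc'
      by_cases hcc : c' = c
      swap
      · exact hy c' (Finset.mem_erase.2 ⟨hcc, hc'⟩)
      subst hcc
      have hlt : ∀ t : ℝ, t ∈ Set.Ioo (0 : ℝ) 1 → Qn ((1 - t : ℝ) * y + (t : ℝ) * y0 - c') ≤ 1 ^ 2 := by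
        intro t ht
        by_contra hcon
        push Not at hcon
        obtain ⟨c2, h2, h2', h2''⟩ := hcm _ (by linarith : 1 ≤ Qn ((1 - t : ℝ) * y + (t : ℝ) * y0 - c'))
        have e : (1 - t : ℝ) * y + (t : ℝ) * y0 - c2 = (1 - t : ℝ) * (y - c2) + (t : ℝ) * (y0 - c2) := by
          push_cast; ring
        rw [e] at h2''
        have := Qn_comb (y - c2) (y0 - c2) t ht.1.le ht.2.le
        have h3 := hy c2 (Finset.mem_erase.2 ⟨h2', h2⟩)
        have h4 := hy0 c2 h2
        nlinarith [ht.1, ht.2]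
      have hcont : Continuous fun t : ℝ => Qn ((1 - t : ℝ) * y + (t : ℝ) * y0 - c') := by
        unfold Qn; fun_prop
      have hlim := (hcont.tendsto 0).mono_left (nhdsWithin_le_nhds (s := Set.Ioi 0))
      have := le_of_tendsto hlim (by
        filter_upwards [Ioo_mem_nhdsGT (zero_lt_one (α := ℝ))] with t ht using hlt t ht)
      simpa using this
    refine (ih _ (Finset.erase_ssubset hc) hne (fun a ha b hb => hdiam a (hsub a ha) b (hsub b hb))
      (fun a ha => hy0 a (hsub a ha))).trans (measure_mono ?_)
    rintro φ ⟨a, ha, h⟩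
    exact ⟨a, hsub a ha, hcap h⟩

/-! ### Jung theorem in the plane -/

lemma jung_small {ι : Type} [Fintype ι] [Nonempty ι] (hcard : Fintype.card ι ≤ 3) {d : ℝ}
    (c : ι → ℂ) (hdiam : ∀ i j, Qn (c i - c j) ≤ d ^ 2) :
    ∃ o : ℂ, ∀ i, Qn (o - c i) ≤ d ^ 2 / 3 := by
  classical
  set V : (ι → ℝ) → ℝ := fun l => ∑ i, l i * Qn (c i) - (∑ i, l i * (c i).re) ^ 2
    - (∑ i, l i * (c i).im) ^ 2 with hV
  have hVc : Continuous V := by fun_prop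
  obtain ⟨l, hl, hmax⟩ := (isCompact_stdSimplex ℝ ι).exists_isMaxOn
    ⟨_, single_mem_stdSimplex ℝ (Classical.arbitrary ι)⟩ hVc.continuousOn
  set a := ∑ i, l i * (c i).re with ha
  set b := ∑ i, l i * (c i).im with hb
  have hl1 : ∑ i, l i = 1 := hl.2
  have hVl : V l = ∑ i, l i * Qn (c i) - a ^ 2 - b ^ 2 := rfl
  -- moment identity
  have hmom : ∀ z : ℂ, ∑ i, l i * Qn (c i - z) = V l + Qn (⟨a, b⟩ - z) := by
    intro z
    have e : ∀ i, l i * Qn (c i - z) = l i * Qn (c i) - 2 * z.re * (l i * (c i).re)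
        - 2 * z.im * (l i * (c i).im) + Qn z * l i := by
      intro i; simp only [Qn, Complex.sub_re, Complex.sub_im]; ring
    simp only [e]
    rw [Finset.sum_add_distrib, Finset.sum_sub_distrib, Finset.sum_sub_distrib, ← Finset.mul_sum,
      ← Finset.mul_sum, ← Finset.mul_sum, hl1, hVl, ← ha, ← hb]
    simp only [Qn, Complex.sub_re, Complex.sub_im]; ring
  have hle : ∀ j, Qn (⟨a, b⟩ - c j) ≤ V l := by
    intro j
    have hstep : ∀ t ∈ Set.Ioo (0 : ℝ) 1, (1 - t) * Qn (⟨a, b⟩ - c j) ≤ V l := by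
      intro t ht
      have hmem : (1 - t) • l + t • Pi.single j 1 ∈ stdSimplex ℝ ι :=
        convex_stdSimplex ℝ ι hl (single_mem_stdSimplex ℝ j) (by linarith [ht.2]) ht.1.le (by ring)
      have h := hmax hmem
      have hs : ∀ f : ι → ℝ, ∑ i, ((1 - t) • l + t • (Pi.single j 1 : ι → ℝ)) i * f i
          = (1 - t) * ∑ i, l i * f i + t * f j := by
        intro f
        simp only [Pi.add_apply, Pi.smul_apply, smul_eq_mul, add_mul, Finset.sum_add_distrib,
          mul_assoc, ← Finset.mul_sum]
        congr 2
        simp [Pi.single_apply]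
      have h' : V ((1 - t) • l + t • (Pi.single j 1 : ι → ℝ)) ≤ V l := h
      have e : V ((1 - t) • l + t • (Pi.single j 1 : ι → ℝ)) =
          (1 - t) * V l + t * (1 - t) * Qn (⟨a, b⟩ - c j) := by
        rw [hVl]
        simp only [hV]
        rw [hs (fun i => Qn (c i)), hs (fun i => (c i).re), hs (fun i => (c i).im), ← ha, ← hb]
        simp only [Qn, Complex.sub_re, Complex.sub_im]; ring
      rw [e] at h'
      have : t * ((1 - t) * Qn (⟨a, b⟩ - c j)) ≤ t * V l := by linarith
      exact le_of_mul_le_mul_left this ht.1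
    have hcont : Continuous fun t : ℝ => (1 - t) * Qn (⟨a, b⟩ - c j) := by fun_prop
    have hlim := (hcont.tendsto 0).mono_left (nhdsWithin_le_nhds (s := Set.Ioi 0))
    have := le_of_tendsto hlim (by
      filter_upwards [Ioo_mem_nhdsGT (zero_lt_one (α := ℝ))] with t ht using hstep t ht)
    simpa using this
  have hVd : V l ≤ d ^ 2 / 3 := by
    have h1 : ∀ j, V l + Qn (⟨a, b⟩ - c j) ≤ d ^ 2 * (1 - l j) := by
      intro j
      rw [← hmom, ← hl1, mul_sub, Finset.mul_sum]
      have : ∑ i, d ^ 2 * l i - d ^ 2 * l j = ∑ i ∈ Finset.univ.erase j, d ^ 2 * l i := by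
        rw [← Finset.add_sum_erase _ _ (Finset.mem_univ j)]; ring
      rw [this, ← Finset.add_sum_erase _ _ (Finset.mem_univ j)]
      have z : Qn (c j - c j) = 0 := by simp [Qn]
      rw [z, mul_zero, zero_add]
      apply Finset.sum_le_sum
      intro i _
      rw [mul_comm]
      exact mul_le_mul_of_nonneg_right (hdiam i j) (hl.1 i)
    have h2 : ∑ j, l j * (V l + Qn (⟨a, b⟩ - c j)) ≤ ∑ j, l j * (d ^ 2 * (1 - l j)) :=
      Finset.sum_le_sum fun j _ => mul_le_mul_of_nonneg_left (h1 j) (hl.1 j)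
    have h3 : ∑ j, l j * (V l + Qn (⟨a, b⟩ - c j)) = 2 * V l := by
      have := hmom ⟨a, b⟩
      have z : Qn ((⟨a, b⟩ : ℂ) - ⟨a, b⟩) = 0 := by simp [Qn]
      rw [z, add_zero] at this
      have sy : ∀ i, Qn (c i - ⟨a, b⟩) = Qn (⟨a, b⟩ - c i) := by
        intro i; simp only [Qn, Complex.sub_re, Complex.sub_im]; ring
      simp only [sy] at this
      simp only [mul_add, Finset.sum_add_distrib, this, ← Finset.sum_mul, hl1]
      ring
    have h4 : ∑ j, l j * (d ^ 2 * (1 - l j)) = d ^ 2 * (1 - ∑ j, l j ^ 2) := by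
      rw [← hl1, ← Finset.sum_sub_distrib, Finset.mul_sum]
      apply Finset.sum_congr rfl
      intro j _
      rw [hl1]; ring
    have h5 : (∑ j, l j) ^ 2 ≤ Fintype.card ι * ∑ j, l j ^ 2 := sq_sum_le_card_mul_sum_sq
    rw [hl1] at h5
    have h6 : (Fintype.card ι : ℝ) ≤ 3 := by exact_mod_cast hcard
    have h7 : 0 ≤ ∑ j, l j ^ 2 := Finset.sum_nonneg fun j _ => sq_nonneg _
    have h8 : 1 / 3 ≤ ∑ j, l j ^ 2 := by nlinarith
    have h9 := sq_nonneg d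
    rw [h3, h4] at h2
    nlinarith
  exact ⟨⟨a, b⟩, fun i => (hle i).trans hVd⟩

lemma jung {S : Finset ℂ} {d : ℝ} (hd : 0 ≤ d) (hdiam : ∀ c ∈ S, ∀ c' ∈ S, Qn (c - c') ≤ d ^ 2) :
    ∃ o : ℂ, ∀ c ∈ S, Qn (o - c) ≤ d ^ 2 / 3 := by
  have hconv : ∀ c ∈ S, Convex ℝ {o : ℂ | Qn (o - c) ≤ d ^ 2 / 3} := by
    intro c _
    have : {o : ℂ | Qn (o - c) ≤ d ^ 2 / 3} = closedBall c (d / Real.sqrt 3) := by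
      ext o
      rw [mem_closedBall, dist_eq_norm, ← Qn_le_iff (by positivity), div_pow,
        Real.sq_sqrt (by norm_num)]
      rfl
    rw [this]
    exact convex_closedBall _ _
  have h := Convex.helly_theorem' (s := S) hconv (by
    intro I hI hcard
    rw [Complex.finrank_real_complex] at hcard
    rcases I.eq_empty_or_nonempty with rfl | hne
    · simp
    have : Nonempty I := hne.to_subtype
    obtain ⟨o, ho⟩ := jung_small (ι := I) (by simpa using hcard) (fun i => (i : ℂ))
      (fun i j => hdiam _ (hI i.2) _ (hI j.2))
    exact ⟨o, Set.mem_iInter₂.2 fun c hc => ho ⟨c, hc⟩⟩)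
  obtain ⟨o, ho⟩ := h
  exact ⟨o, fun c hc => Set.mem_iInter₂.1 ho c hc⟩

/-- Scaled version of `Nset`. -/
def NsetS (S : Finset ℂ) (s : ℝ) : Set Circ := {φ | ∃ c ∈ S, c + s * uC φ ∈ capB S s}

lemma Qn_smul (s : ℝ) (z : ℂ) : Qn (s * z) = s ^ 2 * Qn z := by
  simp [Qn]; ring

lemma scaled_main {S : Finset ℂ} (hS : S.Nonempty) {d s : ℝ} (hd1 : 1 ≤ d) (hs1 : s ≤ 1)
    (hs : d / Real.sqrt 3 < s) (hdiam : ∀ c ∈ S, ∀ c' ∈ S, Qn (c - c') ≤ d ^ 2) :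
    ENNReal.ofReal (2 * π - 6 * Real.arcsin (d / (2 * s))) ≤ volume (NsetS S s) := by
  classical
  have h3 : 0 < Real.sqrt 3 := by positivity
  have h32 : Real.sqrt 3 < 2 := by
    rw [Real.sqrt_lt' (by norm_num)]; norm_num
  have hd0 : 0 < d := by linarith
  have hs0 : 0 < s := lt_trans (by positivity) hs
  rw [div_lt_iff₀ h3] at hs
  obtain ⟨o, ho⟩ := jung hd0.le hdiam
  have hsc : (s : ℂ) ≠ 0 := by exact_mod_cast hs0.ne'
  have key : ∀ z w : ℂ, Qn (z - w) = s ^ 2 * Qn (z / s - w / s) := by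
    intro z w
    rw [← Qn_smul]; congr 1; field_simp
  have hsp : 0 < s ^ 2 := by positivity
  have h := main_lemma (d := d / s) (y0 := o / s) (by rw [le_div_iff₀ hs0]; linarith)
    (by rw [div_lt_iff₀ hs0]; nlinarith) (S.image (fun c => c / (s : ℂ))) (hS.image _)
    (by
      intro a ha b hb
      obtain ⟨a, haS, rfl⟩ := Finset.mem_image.1 ha
      obtain ⟨b, hbS, rfl⟩ := Finset.mem_image.1 hb
      have := hdiam a haS b hbS
      rw [key] at this
      rw [div_pow, le_div_iff₀ hsp]; linarith)
    (by
      intro a ha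
      obtain ⟨a, haS, rfl⟩ := Finset.mem_image.1 ha
      have := ho a haS
      rw [key] at this
      have hq : Real.sqrt 3 ^ 2 = 3 := Real.sq_sqrt (by norm_num)
      have hlt : d ^ 2 < s ^ 2 * 3 := by
        rw [← hq, ← mul_pow]; gcongr
      by_contra hcon
      push Not at hcon
      nlinarith)
  rw [show d / s / 2 = d / (2 * s) by field_simp] at h
  refine h.trans (measure_mono ?_)
  rintro φ ⟨a, ha, hφ⟩
  obtain ⟨a, haS, rfl⟩ := Finset.mem_image.1 ha
  refine ⟨a, haS, fun b hb => ?_⟩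
  have := hφ _ (Finset.mem_image_of_mem _ hb)
  rw [key]
  have e : (a + s * uC φ) / s = a / s + uC φ := by field_simp
  rw [e]
  nlinarith

lemma continuous_uC : Continuous uC := by
  have h1 := continuous_cosC
  have h2 := continuous_sinC
  have : uC = fun φ => (cosC φ : ℂ) + (sinC φ : ℂ) * Complex.I := by
    ext φ; apply Complex.ext <;> simp [uC]
  rw [this]
  fun_prop

lemma continuous_Qn : Continuous Qn := by unfold Qn; fun_prop

lemma isClosed_capB (S : Finset ℂ) (r : ℝ) : IsClosed (capB S r) := by
  have : capB S r = ⋂ c ∈ S, {y | Qn (y - c) ≤ r ^ 2} := by ext; simp [capB]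
  rw [this]
  refine isClosed_biInter fun c _ => isClosed_le (continuous_Qn.comp (by fun_prop)) continuous_const

lemma measurable_NsetS (S : Finset ℂ) (s : ℝ) : MeasurableSet (NsetS S s) := by
  have : NsetS S s = ⋃ c ∈ S, (fun φ => c + s * uC φ) ⁻¹' capB S s := by ext; simp [NsetS]
  rw [this]
  refine Finset.measurableSet_biUnion _ fun c _ => ?_
  have := continuous_uC
  exact ((isClosed_capB S s).preimage (by fun_prop)).measurableSet

/-- Truncated farthest-point Voronoi cell. -/
def Wc (S : Finset ℂ) (c : ℂ) : Set ℂ :=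
  {x | (∀ c' ∈ S, Qn (x - c') ≤ Qn (x - c)) ∧ Qn (x - c) ≤ 1}

lemma isClosed_Wc (S : Finset ℂ) (c : ℂ) : IsClosed (Wc S c) := by
  have : Wc S c = (⋂ c' ∈ S, {x | Qn (x - c') ≤ Qn (x - c)}) ∩ {x | Qn (x - c) ≤ 1} := by
    ext; simp [Wc]
  rw [this]
  have := continuous_Qn
  refine IsClosed.inter (isClosed_biInter fun c' _ => isClosed_le ?_ ?_) (isClosed_le ?_ ?_) <;>
    fun_prop

lemma sum_Wc_le (S : Finset ℂ) : ∑ c ∈ S, volume (Wc S c) ≤ volume (capB S 1) := by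
  rw [← measure_biUnion_finset₀]
  · apply measure_mono
    intro x hx
    simp only [Set.mem_iUnion, exists_prop] at hx
    obtain ⟨c, hc, h1, h2⟩ := hx
    intro c' hc'
    rw [one_pow]
    exact (h1 c' hc').trans h2
  · intro a ha b hb hab
    refine measure_mono_null ?_ (Measure.addHaar_affineSubspace volume
      (AffineSubspace.perpBisector a b) (by rwa [Ne, AffineSubspace.perpBisector_eq_top]))
    intro x hx
    have h1 := hx.1.1 b hb
    have h2 := hx.2.1 a ha
    have h3 := le_antisymm h1 h2
    rw [Qn_eq, Qn_eq, sq_eq_sq₀ (norm_nonneg _) (norm_nonneg _)] at h3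
    rw [SetLike.mem_coe, AffineSubspace.mem_perpBisector_iff_dist_eq, dist_eq_norm, dist_eq_norm]
    exact h3.symm
  · intro c _; exact (isClosed_Wc S c).measurableSet.nullMeasurableSet

lemma vol_polar (S : Finset ℂ) (c : ℂ) : volume (Wc S c) =
    ∫⁻ p in Set.Ioi (0 : ℝ) ×ˢ Set.Ioo (-π) π,
      ENNReal.ofReal p.1 * (Wc S c).indicator 1 (c + p.1 * uvec p.2) := by
  rw [← lintegral_indicator_one (isClosed_Wc S c).measurableSet,
    ← lintegral_add_left_eq_self _ c, ← Complex.lintegral_comp_polarCoord_symm]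
  have : polarCoord.target = Set.Ioi (0 : ℝ) ×ˢ Set.Ioo (-π) π := rfl
  rw [this]
  apply lintegral_congr
  intro p
  rw [smul_eq_mul]
  congr 3
  rw [Complex.polarCoord_symm_apply]
  congr 1
  apply Complex.ext <;> simp [uvec, -Complex.ofReal_sin, -Complex.ofReal_cos]

lemma vol_lower (S : Finset ℂ) {a : ℝ} (ha : 0 ≤ a) :
    ∫⁻ s in Set.Ioc a 1, ENNReal.ofReal s * volume (NsetS S s) ≤ volume (capB S 1) := by
  classical
  refine le_trans ?_ (sum_Wc_le S)
  simp only [vol_polar]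
  have hmeas : ∀ c, Measurable fun p : ℝ × ℝ =>
      ENNReal.ofReal p.1 * (Wc S c).indicator (1 : ℂ → ℝ≥0∞) (c + p.1 * uvec p.2) := by
    intro c
    have hu : Continuous fun p : ℝ × ℝ => c + p.1 * uvec p.2 := by
      have := continuous_uC
      have h2 : Continuous fun p : ℝ × ℝ => uC ((p.2 : ℝ) : Circ) :=
        this.comp ((AddCircle.continuous_mk' _).comp continuous_snd)
      simp only [uC_coe] at h2
      fun_prop
    refine Measurable.mul (by fun_prop) ?_
    exact (measurable_one.indicator (isClosed_Wc S c).measurableSet).comp hu.measurable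
  rw [← lintegral_finsetSum _ (fun c _ => hmeas c), Measure.volume_eq_prod, ← Measure.prod_restrict,
    lintegral_prod _ (Finset.measurable_sum _ (fun c _ => hmeas c)).aemeasurable]
  refine le_trans ?_ (lintegral_mono_set (s := Set.Ioc a 1) (fun x hx => lt_of_le_of_lt ha hx.1))
  apply setLIntegral_mono' measurableSet_Ioc
  intro s hs
  have hs0 : 0 < s := lt_of_le_of_lt ha hs.1
  have hmp := AddCircle.measurePreserving_mk (2 * π) (-π)
  rw [show -π + 2 * π = π by ring, ← restrict_Ioo_eq_restrict_Ioc] at hmp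
  have hpre : MeasurableSet ((fun t : ℝ => (t : Circ)) ⁻¹' NsetS S s) :=
    hmp.measurable (measurable_NsetS S s)
  rw [← hmp.measure_preimage (measurable_NsetS S s).nullMeasurableSet,
    ← lintegral_indicator_one hpre, ← lintegral_const_mul _ (measurable_one.indicator hpre)]
  apply lintegral_mono
  intro t
  dsimp only
  rw [← Finset.mul_sum]
  gcongr
  by_cases ht : t ∈ (fun t : ℝ => (t : Circ)) ⁻¹' NsetS S s
  swap
  · rw [Set.indicator_of_notMem ht]; exact zero_le
  · rw [Set.indicator_of_mem ht]
    obtain ⟨c, hc, h⟩ := ht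
    rw [uC_coe] at h
    have hW : c + s * uvec t ∈ Wc S c := by
      have e : Qn (c + s * uvec t - c) = s ^ 2 := by
        rw [add_sub_cancel_left, Qn_smul, Qn_uvec, mul_one]
      refine ⟨fun c' hc' => ?_, ?_⟩
      · rw [e]; exact h c' hc'
      · rw [e]; nlinarith [hs.2]
    refine le_trans (le_of_eq ?_) (Finset.single_le_sum (f := fun c =>
      (Wc S c).indicator (1 : ℂ → ℝ≥0∞) (c + s * uvec t)) (fun _ _ => zero_le) hc)
    rw [Set.indicator_of_mem hW]; rfl

lemma integral_calc {d : ℝ} (hd1 : 1 ≤ d) (hd2 : d < Real.sqrt 3) :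
    ∫ s in (d / Real.sqrt 3)..1, s * (2 * π - 6 * Real.arcsin (d / (2 * s))) =
    3 * Real.arccos (d / 2) + Real.sqrt 3 / 4 * d ^ 2
        - 3 / 4 * d * Real.sqrt (4 - d ^ 2) - π / 2 := by
  have h3 : 0 < Real.sqrt 3 := by positivity
  have hq : Real.sqrt 3 ^ 2 = 3 := Real.sq_sqrt (by norm_num)
  have hd0 : 0 < d := by linarith
  have ha0 : 0 < d / Real.sqrt 3 := by positivity
  have ha1 : d / Real.sqrt 3 ≤ 1 := by rw [div_le_one h3]; exact hd2.le
  have hicc : ∀ s ∈ Set.uIcc (d / Real.sqrt 3) 1, 0 < s ∧ d ^ 2 < 4 * s ^ 2 := by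
    intro s hs
    rw [Set.uIcc_of_le ha1] at hs
    refine ⟨lt_of_lt_of_le ha0 hs.1, ?_⟩
    have : d ≤ s * Real.sqrt 3 := by rw [← div_le_iff₀ h3]; exact hs.1
    have h2 : d ^ 2 ≤ (s * Real.sqrt 3) ^ 2 := by gcongr
    rw [mul_pow, hq] at h2
    have : 0 < s ^ 2 := by have := lt_of_lt_of_le ha0 hs.1; positivity
    linarith
  set F : ℝ → ℝ := fun s => π * s ^ 2 - 3 * (s ^ 2 * Real.arcsin (d / (2 * s)))
    - 3 * d / 4 * Real.sqrt (4 * s ^ 2 - d ^ 2) with hF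
  have hder : ∀ s ∈ Set.uIcc (d / Real.sqrt 3) 1,
      HasDerivAt F (s * (2 * π - 6 * Real.arcsin (d / (2 * s)))) s := by
    intro s hs
    obtain ⟨s0, s1⟩ := hicc s hs
    have hpos : 0 < 4 * s ^ 2 - d ^ 2 := by linarith
    have hlt : d / (2 * s) < 1 := by
      rw [div_lt_one (by positivity)]
      nlinarith
    have hgt : 0 < d / (2 * s) := by positivity
    have e1 : HasDerivAt (fun s : ℝ => d / (2 * s)) (-d / (2 * s ^ 2)) s := by
      have := ((hasDerivAt_id s).const_mul 2).inv (by simpa using s0.ne') |>.const_mul d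
      refine this.congr_deriv ?_
      simp only [id]
      field_simp
    have e2 := (Real.hasDerivAt_arcsin (x := d / (2 * s)) (by linarith) (by linarith)).comp s e1
    have e3 : HasDerivAt (fun s : ℝ => s ^ 2) (2 * s) s := by simpa using hasDerivAt_pow 2 s
    have e4 : HasDerivAt (fun s : ℝ => 4 * s ^ 2 - d ^ 2) (4 * (2 * s)) s :=
      (e3.const_mul 4).sub_const _
    have e5 := e4.sqrt hpos.ne'
    have e6 := ((e3.const_mul π).sub ((e3.mul e2).const_mul 3)).sub (e5.const_mul (3 * d / 4))
    have hr : Real.sqrt (1 - (d / (2 * s)) ^ 2) = Real.sqrt (4 * s ^ 2 - d ^ 2) / (2 * s) := by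
      rw [show 1 - (d / (2 * s)) ^ 2 = (4 * s ^ 2 - d ^ 2) / (2 * s) ^ 2 by field_simp; ring,
        Real.sqrt_div' _ (by positivity), Real.sqrt_sq (by positivity)]
    have hne : Real.sqrt (4 * s ^ 2 - d ^ 2) ≠ 0 := (Real.sqrt_pos.2 hpos).ne'
    refine e6.congr_deriv ?_
    rw [hr]
    simp only [Function.comp]
    field_simp
    ring
  have hcont : ContinuousOn (fun s => s * (2 * π - 6 * Real.arcsin (d / (2 * s))))
      (Set.uIcc (d / Real.sqrt 3) 1) := by
    have : ContinuousOn (fun s : ℝ => d / (2 * s)) (Set.uIcc (d / Real.sqrt 3) 1) := by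
      apply ContinuousOn.div continuousOn_const (by fun_prop)
      intro s hs
      have := (hicc s hs).1
      positivity
    have := Real.continuous_arcsin.comp_continuousOn this
    exact continuousOn_id.mul (continuousOn_const.sub (continuousOn_const.mul this))
  rw [intervalIntegral.integral_eq_sub_of_hasDerivAt hder hcont.intervalIntegrable]
  simp only [hF]
  have b1 : d / (2 * (d / Real.sqrt 3)) = Real.sqrt 3 / 2 := by field_simp
  have b2 : Real.arcsin (Real.sqrt 3 / 2) = π / 3 := by
    rw [← Real.sin_pi_div_three, Real.arcsin_sin] <;> linarith [Real.pi_pos]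
  have b3 : Real.sqrt (4 * (d / Real.sqrt 3) ^ 2 - d ^ 2) = d / Real.sqrt 3 := by
    rw [← Real.sqrt_sq ha0.le]
    congr 1
    rw [Real.sqrt_sq ha0.le, div_pow, hq]; ring
  have b4 : d / Real.sqrt 3 = d * Real.sqrt 3 / 3 := by
    rw [div_eq_div_iff h3.ne' (by norm_num)]
    rw [mul_assoc, ← sq, hq]
  rw [b1, b2, b3, Real.arccos_eq_pi_div_two_sub_arcsin, b4]
  rw [show d / (2 * 1) = d / 2 by ring, show 4 * (1 : ℝ) ^ 2 - d ^ 2 = 4 - d ^ 2 by ring]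
  ring

lemma area_complex {d : ℝ} (hd1 : 1 ≤ d) (hd2 : d < Real.sqrt 3) {S : Finset ℂ} (hS : S.Nonempty)
    (hdiam : ∀ c ∈ S, ∀ c' ∈ S, Qn (c - c') ≤ d ^ 2) :
    ENNReal.ofReal (3 * Real.arccos (d / 2) + Real.sqrt 3 / 4 * d ^ 2
        - 3 / 4 * d * Real.sqrt (4 - d ^ 2) - π / 2) ≤ volume (capB S 1) := by
  have h3 : 0 < Real.sqrt 3 := by positivity
  have hd0 : 0 < d := by linarith
  have ha0 : 0 < d / Real.sqrt 3 := by positivity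
  have ha1 : d / Real.sqrt 3 ≤ 1 := by rw [div_le_one h3]; exact hd2.le
  rw [← integral_calc hd1 hd2, intervalIntegral.integral_of_le ha1]
  refine le_trans ?_ (vol_lower S ha0.le)
  have hnn : ∀ s ∈ Set.Ioc (d / Real.sqrt 3) 1, 0 ≤ 2 * π - 6 * Real.arcsin (d / (2 * s)) := by
    intro s hs
    have hs0 : 0 < s := ha0.trans hs.1
    have : Real.arcsin (d / (2 * s)) ≤ π / 3 := by
      rw [Real.arcsin_le_iff_le_sin' ⟨by linarith [Real.pi_pos], by linarith [Real.pi_pos]⟩,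
        Real.sin_pi_div_three]
      rw [div_le_div_iff₀ (by positivity) (by norm_num)]
      have := (div_lt_iff₀ h3).1 hs.1
      linarith
    linarith
  have hcont : ContinuousOn (fun s => s * (2 * π - 6 * Real.arcsin (d / (2 * s))))
      (Set.Icc (d / Real.sqrt 3) 1) := by
    have : ContinuousOn (fun s : ℝ => d / (2 * s)) (Set.Icc (d / Real.sqrt 3) 1) := by
      apply ContinuousOn.div continuousOn_const (by fun_prop)
      intro s hs
      have := lt_of_lt_of_le ha0 hs.1
      positivity
    have := Real.continuous_arcsin.comp_continuousOn this
    exact continuousOn_id.mul (continuousOn_const.sub (continuousOn_const.mul this))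
  rw [ofReal_integral_eq_lintegral_ofReal]
  · apply setLIntegral_mono' measurableSet_Ioc
    intro s hs
    rw [ENNReal.ofReal_mul (ha0.trans hs.1).le]
    gcongr
    exact scaled_main hS hd1 hs.2 hs.1 hdiam
  · exact (hcont.integrableOn_Icc).mono_set Set.Ioc_subset_Icc_self
  · filter_upwards [ae_restrict_mem measurableSet_Ioc] with s hs
    exact mul_nonneg (ha0.trans hs.1).le (hnn s hs)

/-- Theorem 1 of the paper: a disk-polygon with center parameter `d`,
`1 ≤ d < √3`, has area at least that of the regular disk-triangle `Δ(d)`. -/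
theorem area_ge_regular_disk_triangle (d : ℝ) (hd1 : 1 ≤ d) (hd2 : d < Real.sqrt 3)
    (S : Finset E2) (hS : S.Nonempty) (D : Set E2)
    (hD : D = ⋂ c ∈ S, closedBall c 1) (hint : (interior D).Nonempty)
    (hcp : ∀ c ∈ S, ∀ c' ∈ S, dist c c' ≤ d) :
    ENNReal.ofReal (3 * Real.arccos (d / 2) + Real.sqrt 3 / 4 * d ^ 2
        - 3 / 4 * d * Real.sqrt (4 - d ^ 2) - π / 2) ≤ volume D := by
  classical
  let e : ℂ ≃ₗᵢ[ℝ] E2 := Complex.orthonormalBasisOneI.repr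
  have hd0 : 0 ≤ d := by linarith
  have hDc : IsClosed D := by
    rw [hD]; exact isClosed_biInter fun c _ => isClosed_closedBall
  have hmp : MeasurePreserving e volume volume := e.measurePreserving
  rw [← hmp.measure_preimage hDc.measurableSet.nullMeasurableSet]
  have hQ : ∀ z : ℂ, ∀ c : E2, ∀ r : ℝ, 0 ≤ r → (Qn (z - e.symm c) ≤ r ^ 2 ↔ dist (e z) c ≤ r) := by
    intro z c r hr
    rw [Qn_le_iff hr, ← dist_eq_norm, ← e.dist_map, e.apply_symm_apply]
  have hcap : e ⁻¹' D = capB (S.image e.symm) 1 := by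
    ext z
    simp only [hD, Set.mem_preimage, Set.mem_iInter, mem_closedBall, capB, Set.mem_setOf_eq,
      Finset.forall_mem_image]
    exact forall₂_congr fun c _ => (hQ z c 1 zero_le_one).symm
  rw [hcap]
  apply area_complex hd1 hd2 (hS.image _)
  simp only [Finset.forall_mem_image]
  intro a ha b hb
  rw [hQ _ _ _ hd0, e.apply_symm_apply]
  exact hcp a ha b hb
end
end

section
/- Let D be a disk-polygon with center parameter d, where 1 ≤ d < √3. Then the minimal width of D is at least the minimal width of the regular disk-triangle Δ(d); explicitly, w(D) ≥ 1 − (1/2)·√(4 + 2d² − 2√3·d·√(4 − d²)). -/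
open Metric Real MeasureTheory
open scoped InnerProductSpace Pointwise ENNReal

noncomputable section

lemma unit_le (a b : ℝ) (h : a ^ 2 + b ^ 2 = 1) : b ≤ 1 := by
  nlinarith [sq_nonneg a]

/-- Key planar contradiction, in an orthonormal frame with `u = (0,1)`. -/
lemma core_aux (d k r0 w en eu fn fu gn gu l m : ℝ) (hk : 0 < k) (hkd : 4 * k ^ 2 = 4 - d ^ 2)
    (hr0 : 0 ≤ r0) (hr : r0 ^ 2 + 2 * r0 * k = d ^ 2 - 1) (hw : 0 ≤ w) (hw1 : r0 < 1 - w)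
    (he : en ^ 2 + eu ^ 2 = 1) (hke : k ≤ eu) (hf : fn ^ 2 + fu ^ 2 = 1)
    (hg : gn ^ 2 + gu ^ 2 = 1) (hl : 0 ≤ l) (hm : 0 ≤ m) (h0 : l * fn + m * gn = 0)
    (h1 : l * fu + m * gu = 1) (hfg : (fn - gn) ^ 2 + (fu - gu) ^ 2 ≤ d ^ 2)
    (hfc : (fn + en) ^ 2 + (fu - (w - eu)) ^ 2 ≤ d ^ 2)
    (hgc : (gn + en) ^ 2 + (gu - (w - eu)) ^ 2 ≤ d ^ 2)
    (hen : 0 ≤ en) (hfn : 0 ≤ fn) : False := by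
  obtain ⟨M, hM⟩ : ∃ M, M = eu - w := ⟨_, rfl⟩
  obtain ⟨R, hR⟩ : ∃ R, R = en ^ 2 + M ^ 2 := ⟨_, rfl⟩
  obtain ⟨H, hH⟩ : ∃ H, H = (d ^ 2 - 1 - R) / 2 := ⟨_, rfl⟩
  have heu1 : eu ≤ 1 := unit_le en eu he
  have hRv : R = 1 + w ^ 2 - 2 * w * eu := by rw [hR, hM]; linear_combination he
  have hfM : fn * en + fu * M ≤ H := by
    have h : (fn + en) ^ 2 + (fu - (w - eu)) ^ 2 = 1 + R + 2 * (fn * en + fu * M) := by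
      rw [hR, hM]; linear_combination hf
    rw [hH]; linarith
  have hgM : gn * en + gu * M ≤ H := by
    have h : (gn + en) ^ 2 + (gu - (w - eu)) ^ 2 = 1 + R + 2 * (gn * en + gu * M) := by
      rw [hR, hM]; linear_combination hg
    rw [hH]; linarith
  have huM : H < M := by
    have : 0 < 2 * eu * (1 - w) + (1 - w) ^ 2 + 1 - d ^ 2 := by
      have a1 := mul_le_mul_of_nonneg_right hke (hr0.trans hw1.le)
      have a2 := mul_lt_mul_of_pos_left hw1 hk
      have a3 := pow_lt_pow_left₀ hw1 hr0 two_ne_zero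
      linarith
    rw [hH, hRv, hM]; linarith
  have hRge : (1 - w) ^ 2 ≤ R := by
    rw [hRv]
    have := mul_nonneg hw (by linarith : 0 ≤ 1 - eu)
    linarith
  have hs0 : 0 ≤ Real.sqrt R := Real.sqrt_nonneg _
  have hR0 : 0 ≤ R := (sq_nonneg _).trans hRge
  have hs2 : Real.sqrt R ^ 2 = R := Real.sq_sqrt hR0
  obtain ⟨s, hs⟩ : ∃ s, s = Real.sqrt R := ⟨_, rfl⟩
  rw [← hs] at hs0 hs2
  have hsr : r0 < s := by
    have : 1 - w ≤ s := abs_le_of_sq_le_sq' (by rw [hs2]; exact hRge) hs0 |>.2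
    linarith
  have hHk : H < s * k := by
    rw [hH, ← hs2]
    have a1 := pow_lt_pow_left₀ hsr hr0 two_ne_zero
    have a2 := mul_lt_mul_of_pos_right hsr hk
    linarith
  -- lower bound for combinations of f and g
  have comb : ∀ α β : ℝ, 0 ≤ α → 0 ≤ β →
      (α + β) ^ 2 * k ^ 2 ≤ (α * fn + β * gn) ^ 2 + (α * fu + β * gu) ^ 2 := by
    intro α β ha hb
    have hc : d ^ 2 = 4 - 4 * k ^ 2 := by linarith
    have e1 : (α * fn + β * gn) ^ 2 + (α * fu + β * gu) ^ 2
      = α ^ 2 + β ^ 2 + 2 * (α * β) * (fn * gn + fu * gu) := by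
      linear_combination α ^ 2 * hf + β ^ 2 * hg
    have e2 : 2 * k ^ 2 - 1 ≤ fn * gn + fu * gu := by
      linear_combination (1 / 2) * hfg + (1 / 2) * hc - (1 / 2) * hf - (1 / 2) * hg
    have hk1 : k ≤ 1 := hke.trans heu1
    have e3 := mul_le_mul_of_nonneg_left e2 (mul_nonneg ha hb)
    rw [e1]
    have : 0 ≤ (α - β) ^ 2 * (1 - k ^ 2) := mul_nonneg (sq_nonneg _) (by
      have := pow_le_one₀ (n := 2) hk.le hk1
      linarith)
    linarith
  have uM : M = l * (fn * en + fu * M) + m * (gn * en + gu * M) := by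
    linear_combination (-en) * h0 - M * h1
  by_cases hHn : H ≤ 0
  · -- the easy case
    have hlm : 1 ≤ l + m := by
      have a1 : fu ≤ 1 := unit_le fn fu hf
      have a2 : gu ≤ 1 := unit_le gn gu hg
      have a3 := mul_le_mul_of_nonneg_left a1 hl
      have a4 := mul_le_mul_of_nonneg_left a2 hm
      linarith
    have := mul_le_mul_of_nonneg_left hfM hl
    have := mul_le_mul_of_nonneg_left hgM hm
    have := mul_le_mul_of_nonpos_right hlm hHn
    linarith
  push Not at hHn
  have hMpos : 0 < M := hHn.trans huM
  rcases hfn.eq_or_lt with hfn0 | hfpos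
  · rw [← hfn0] at hf hfM h0
    have : (fu - 1) * (fu + 1) = 0 := by linear_combination hf
    rcases mul_eq_zero.1 this with h | h
    · have : fu = 1 := by linarith
      rw [this] at hfM; linarith
    · have hfu : fu = -1 := by linarith
      rw [hfu] at h1
      have hmg : m * gu = 1 + l := by linarith
      have hm0 : m ≠ 0 := by rintro rfl; linarith
      have hgn : gn = 0 := by
        have : m * gn = 0 := by linarith
        exact (mul_eq_zero.1 this).resolve_left hm0
      have hgp : 0 < gu := by
        by_contra hcon
        push Not at hcon
        have := mul_nonpos_of_nonneg_of_nonpos hm hcon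
        linarith
      have : gu = 1 := by
        rw [hgn] at hg
        have h2 : (gu - 1) * (gu + 1) = 0 := by linear_combination hg
        rcases mul_eq_zero.1 h2 with h3 | h3 <;> linarith
      rw [this, hgn] at hgM; linarith
  rcases le_or_gt (en * fu - M * fn) 0 with hc | hc
  · -- M between u and f : fn * Mvec = en * f + (M fn - en fu) u
    obtain ⟨b, hb⟩ : ∃ b, b = M * fn - en * fu := ⟨_, rfl⟩
    have hb0 : 0 ≤ b := by rw [hb]; linarith
    have hA : 0 ≤ en + b * l := by positivity
    have hB : 0 ≤ b * m := by positivity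
    have hcb := comb (en + b * l) (b * m) hA hB
    have t1 : (en + b * l) * fn + b * m * gn = fn * en := by linear_combination b * h0
    have t2 : (en + b * l) * fu + b * m * gu = fn * M := by
      linear_combination b * h1 + hb
    rw [t1, t2] at hcb
    have t3 : fn * R = (en + b * l) * (fn * en + fu * M) + b * m * (gn * en + gu * M) := by
      rw [hR]; linear_combination (-en) * t1 - M * t2
    obtain ⟨σ, hσ⟩ : ∃ σ, σ = (en + b * l) + b * m := ⟨_, rfl⟩
    have hσ0 : 0 ≤ σ := by rw [hσ]; positivity
    rw [← hσ] at hcb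
    have t4 : fn * R ≤ σ * H := by
      rw [t3, hσ]
      have a1 := mul_le_mul_of_nonneg_left hfM hA
      have a2 := mul_le_mul_of_nonneg_left hgM hB
      linarith
    have hspos : 0 < s := hr0.trans_lt hsr
    have t5 : (σ * k) ^ 2 ≤ (fn * s) ^ 2 := by
      calc (σ * k) ^ 2 = σ ^ 2 * k ^ 2 := by ring
        _ ≤ _ := hcb
        _ = fn ^ 2 * R := by rw [hR]; ring
        _ = _ := by rw [← hs2]; ring
    have t6 : σ * k ≤ fn * s := abs_le_of_sq_le_sq' t5 (by positivity) |>.2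
    have hRpos : 0 < R := by rw [← hs2]; positivity
    have hσpos : 0 < σ := by
      rcases hσ0.eq_or_lt with h | h
      · rw [← h] at t4
        have : 0 < fn * R := by positivity
        linarith
      · exact h
    have t7 : σ * H < σ * (s * k) := mul_lt_mul_of_pos_left hHk hσpos
    have t8 : σ * k * s ≤ fn * s * s := mul_le_mul_of_nonneg_right t6 hs0
    have t9 : fn * s * s = fn * R := by rw [← hs2]; ring
    linarith
  · -- f between u and M
    rcases hen.eq_or_lt with h | henpos
    · rw [← h] at hc
      have := mul_pos hMpos hfpos
      linarith
    obtain ⟨q, hq⟩ : ∃ q, q = en * fu - M * fn := ⟨_, rfl⟩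
    rw [← hq] at hc
    -- en * f = q u + fn * Mvec
    have t1 : en * (fn * en + fu * M) = q * M + fn * R := by rw [hR, hq]; ring
    have hMs : M ≤ s := abs_le_of_sq_le_sq' (by rw [hs2, hR]; linarith [sq_nonneg en]) hs0 |>.2
    have hspos : 0 < s := hMpos.trans_le hMs
    -- en ≤ q + fn * s
    have t2 : en ^ 2 = q ^ 2 + 2 * q * fn * M + fn ^ 2 * s ^ 2 := by
      rw [hs2, hR, hq]; linear_combination (-(en ^ 2)) * hf
    have t3 : en ≤ q + fn * s := by
      have : en ^ 2 ≤ (q + fn * s) ^ 2 := by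
        have := mul_le_mul_of_nonneg_left hMs (mul_nonneg hc.le hfpos.le)
        linarith
      exact abs_le_of_sq_le_sq' this (by positivity) |>.2
    have t4 : en * M ≤ q * M + fn * R := by
      have a := mul_le_mul_of_nonneg_right t3 hMpos.le
      have b : fn * s * M ≤ fn * s * s := mul_le_mul_of_nonneg_left hMs (by positivity)
      have : fn * s * s = fn * R := by rw [← hs2]; ring
      linarith
    have t5 : en * (fn * en + fu * M) ≤ en * H := mul_le_mul_of_nonneg_left hfM hen
    have := mul_lt_mul_of_pos_left huM henpos
    linarith

/-- The same without the sign normalisation. -/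
lemma core_frame (d k r0 w en eu fn fu gn gu l m : ℝ) (hk : 0 < k) (hkd : 4 * k ^ 2 = 4 - d ^ 2)
    (hr0 : 0 ≤ r0) (hr : r0 ^ 2 + 2 * r0 * k = d ^ 2 - 1) (hw : 0 ≤ w) (hw1 : r0 < 1 - w)
    (he : en ^ 2 + eu ^ 2 = 1) (hke : k ≤ eu) (hf : fn ^ 2 + fu ^ 2 = 1)
    (hg : gn ^ 2 + gu ^ 2 = 1) (hl : 0 ≤ l) (hm : 0 ≤ m) (h0 : l * fn + m * gn = 0)
    (h1 : l * fu + m * gu = 1) (hfg : (fn - gn) ^ 2 + (fu - gu) ^ 2 ≤ d ^ 2)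
    (hfc : (fn + en) ^ 2 + (fu - (w - eu)) ^ 2 ≤ d ^ 2)
    (hgc : (gn + en) ^ 2 + (gu - (w - eu)) ^ 2 ≤ d ^ 2) : False := by
  -- one of fn, gn is nonnegative, and one is nonpositive
  have key : ∀ a b : ℝ, (a ^ 2 + fu ^ 2 = 1) → (b ^ 2 + gu ^ 2 = 1) → l * a + m * b = 0 →
      0 ≤ a ∨ 0 ≤ b := by
    intro a b ha hb hab
    by_contra hcon
    push Not at hcon
    have h2 : l * a ≤ 0 := mul_nonpos_of_nonneg_of_nonpos hl hcon.1.le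
    have h3 : m * b ≤ 0 := mul_nonpos_of_nonneg_of_nonpos hm hcon.2.le
    have hl0 : l = 0 := (mul_eq_zero.1 (by linarith : l * a = 0)).resolve_right hcon.1.ne
    have hm0 : m = 0 := (mul_eq_zero.1 (by linarith : m * b = 0)).resolve_right hcon.2.ne
    rw [hl0, hm0] at h1
    norm_num at h1
  have h0' : m * gn + l * fn = 0 := by linarith
  have h1' : m * gu + l * fu = 1 := by linarith
  have hgf : (gn - fn) ^ 2 + (gu - fu) ^ 2 ≤ d ^ 2 := by linear_combination hfg
  rcases le_total 0 en with h | h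
  · rcases key fn gn hf hg h0 with h' | h'
    · exact core_aux d k r0 w en eu fn fu gn gu l m hk hkd hr0 hr hw hw1 he hke hf hg hl hm h0 h1
        hfg hfc hgc h h'
    · exact core_aux d k r0 w en eu gn gu fn fu m l hk hkd hr0 hr hw hw1 he hke hg hf hm hl h0' h1'
        hgf hgc hfc h h'
  · rcases key (-fn) (-gn) (by simpa using hf) (by simpa using hg) (by linarith) with h' | h'
    · exact core_aux d k r0 w (-en) eu (-fn) fu (-gn) gu l m hk hkd hr0 hr hw hw1 (by simpa using he)
        hke (by simpa using hf) (by simpa using hg) hl hm (by linarith) h1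
        (by linear_combination hfg) (by linear_combination hfc) (by linear_combination hgc)
        (by linarith) h'
    · exact core_aux d k r0 w (-en) eu (-gn) gu (-fn) fu m l hk hkd hr0 hr hw hw1 (by simpa using he)
        hke (by simpa using hg) (by simpa using hf) hm hl (by linarith) h1'
        (by linear_combination hfg) (by linear_combination hgc) (by linear_combination hfc)
        (by linarith) h'

lemma inner_coord (x y : E2) : ⟪x, y⟫_ℝ = x 0 * y 0 + x 1 * y 1 := by
  simp [PiLp.inner_apply, Fin.sum_univ_two, mul_comm]

lemma normsq_coord (x : E2) : ‖x‖ ^ 2 = x 0 ^ 2 + x 1 ^ 2 := by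
  rw [← real_inner_self_eq_norm_sq, inner_coord]; ring

/-- First order optimality condition at a top point. -/
lemma kkt_s3 (S : Finset E2) (D : Set E2) (hD : D = ⋂ c ∈ S, closedBall c 1)
    (hint : (interior D).Nonempty) (u x : E2) (hx : x ∈ D)
    (hmax : ∀ y ∈ D, ⟪y, u⟫_ℝ ≤ ⟪x, u⟫_ℝ) (v : E2) (hv : 0 < ⟪v, u⟫_ℝ) :
    ∃ c ∈ S, ‖x - c‖ = 1 ∧ 0 < ⟪v, x - c⟫_ℝ := by
  by_contra hcon
  push Not at hcon
  have memD : ∀ y, y ∈ D ↔ ∀ c ∈ S, ‖y - c‖ ≤ 1 := by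
    intro y; rw [hD]; simp [mem_closedBall, dist_eq_norm]
  obtain ⟨x0, hx0⟩ := hint
  have hx0c : ∀ c ∈ S, ‖x0 - c‖ < 1 := by
    intro c hc
    have : interior D ⊆ ball c 1 := by
      rw [← interior_closedBall c one_ne_zero]
      apply interior_mono
      rw [hD]
      exact Set.biInter_subset_of_mem hc
    simpa [mem_ball, dist_eq_norm] using this hx0
  have hv0 : ∀ c ∈ S, ‖x - c‖ = 1 → ⟪x0 - x, x - c⟫_ℝ < 0 := by
    intro c hc h1
    have h2 := hx0c c hc
    have h3 : x0 - c = (x0 - x) + (x - c) := by abel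
    have h4 := norm_add_sq_real (x0 - x) (x - c)
    rw [← h3, h1] at h4
    nlinarith [norm_nonneg (x0 - c), sq_nonneg ‖x0 - x‖]
  -- perturb
  obtain ⟨ε, hε, hεu⟩ : ∃ ε : ℝ, 0 < ε ∧ 0 < ⟪v + ε • (x0 - x), u⟫_ℝ := by
    have hcont : Filter.Tendsto (fun ε : ℝ => ⟪v + ε • (x0 - x), u⟫_ℝ) (nhdsWithin 0 (Set.Ioi 0))
        (nhds ⟪v + (0 : ℝ) • (x0 - x), u⟫_ℝ) := by
      apply Filter.Tendsto.mono_left _ nhdsWithin_le_nhds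
      exact Continuous.tendsto (by fun_prop) 0
    rw [zero_smul, add_zero] at hcont
    have := (hcont.eventually (lt_mem_nhds hv)).and self_mem_nhdsWithin
    obtain ⟨ε, h1, h2⟩ := this.exists
    exact ⟨ε, h2, h1⟩
  obtain ⟨v', hv'⟩ : ∃ v', v' = v + ε • (x0 - x) := ⟨_, rfl⟩
  rw [← hv'] at hεu
  have hact : ∀ c ∈ S, ‖x - c‖ = 1 → ⟪v', x - c⟫_ℝ < 0 := by
    intro c hc h1
    rw [hv', inner_add_left, real_inner_smul_left]
    have := mul_neg_of_pos_of_neg hε (hv0 c hc h1)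
    linarith [hcon c hc h1]
  have hev : ∀ c ∈ S, ∀ᶠ t : ℝ in nhdsWithin 0 (Set.Ioi 0), ‖x + t • v' - c‖ ≤ 1 := by
    intro c hc
    rcases ((memD x).1 hx c hc).lt_or_eq with h | h
    · have hcont : Filter.Tendsto (fun t : ℝ => ‖x + t • v' - c‖) (nhdsWithin 0 (Set.Ioi 0))
          (nhds ‖x + (0 : ℝ) • v' - c‖) := by
        apply Filter.Tendsto.mono_left _ nhdsWithin_le_nhds
        exact Continuous.tendsto (by fun_prop) 0
      rw [zero_smul, add_zero] at hcont
      exact (hcont.eventually (gt_mem_nhds h)).mono fun t ht => le_of_lt ht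
    · have hn := hact c hc h
      have hcont : Filter.Tendsto (fun t : ℝ => t * ‖v'‖ ^ 2 + 2 * ⟪v', x - c⟫_ℝ)
          (nhdsWithin 0 (Set.Ioi 0)) (nhds (0 * ‖v'‖ ^ 2 + 2 * ⟪v', x - c⟫_ℝ)) := by
        apply Filter.Tendsto.mono_left _ nhdsWithin_le_nhds
        exact Continuous.tendsto (f := fun t : ℝ => t * ‖v'‖ ^ 2 + 2 * ⟪v', x - c⟫_ℝ)
          (by fun_prop) 0
      have hneg : 0 * ‖v'‖ ^ 2 + 2 * ⟪v', x - c⟫_ℝ < 0 := by linarith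
      filter_upwards [hcont.eventually (gt_mem_nhds hneg), self_mem_nhdsWithin] with t ht ht0
      have ht0' : (0 : ℝ) < t := ht0
      have h3 : x + t • v' - c = t • v' + (x - c) := by abel
      have h4 := norm_add_sq_real (t • v') (x - c)
      rw [← h3, h, real_inner_smul_left, norm_smul, Real.norm_of_nonneg ht0'.le] at h4
      have h5 := mul_neg_of_pos_of_neg ht0' ht
      have : ‖x + t • v' - c‖ ^ 2 ≤ 1 ^ 2 := by nlinarith
      exact abs_le_of_sq_le_sq' this (by norm_num) |>.2
  have hall : ∀ᶠ t : ℝ in nhdsWithin 0 (Set.Ioi 0), ∀ c ∈ S, ‖x + t • v' - c‖ ≤ 1 :=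
    (Filter.eventually_all_finset S).2 hev
  obtain ⟨t, ht, ht0⟩ := (hall.and self_mem_nhdsWithin).exists
  have ht0' : (0 : ℝ) < t := ht0
  have := hmax _ ((memD _).2 ht)
  rw [inner_add_left, real_inner_smul_left] at this
  have := mul_pos ht0' hεu
  linarith

lemma gram_sign (p q r : ℝ) (hp : 0 < p) (hqp : q ≤ p) (hrq : p * r < q) (hrm : -1 ≤ r) :
    r < 1 ∧ 0 ≤ p - r * q := by
  have hr1 : r < 1 := by
    by_contra hcon
    push Not at hcon
    nlinarith
  refine ⟨hr1, ?_⟩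
  rcases le_or_gt 0 r with h | h
  · have h1 := mul_le_mul_of_nonneg_left hqp h
    have h2 := mul_le_mul_of_nonneg_right hr1.le hp.le
    linarith
  · rcases le_or_gt 0 q with h' | h'
    · have := mul_nonpos_of_nonpos_of_nonneg h.le h'
      linarith
    · have h1 := mul_nonpos_of_nonneg_of_nonpos (by linarith : 0 ≤ r + 1) h'.le
      have h2 := mul_nonneg (by linarith : 0 ≤ r + 1) hp.le
      linarith

lemma gram (e0 e1 f0 f1 u0 u1 : ℝ) (he : e0 ^ 2 + e1 ^ 2 = 1) (hf : f0 ^ 2 + f1 ^ 2 = 1)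
    (hp : 0 < e0 * u0 + e1 * u1) (hqp : f0 * u0 + f1 * u1 ≤ e0 * u0 + e1 * u1)
    (hrq : (e0 * u0 + e1 * u1) * (e0 * f0 + e1 * f1) < f0 * u0 + f1 * u1) :
    ∃ l m : ℝ, 0 ≤ l ∧ 0 ≤ m ∧ u0 = l * e0 + m * f0 ∧ u1 = l * e1 + m * f1 := by
  obtain ⟨X, hX⟩ : ∃ X, X = e0 * f1 - e1 * f0 := ⟨_, rfl⟩
  have hX2 : X ^ 2 = 1 - (e0 * f0 + e1 * f1) ^ 2 := by
    rw [hX]; linear_combination (f0 ^ 2 + f1 ^ 2) * he + hf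
  have hrm : -1 ≤ e0 * f0 + e1 * f1 := by nlinarith [sq_nonneg (e0 + f0), sq_nonneg (e1 + f1)]
  obtain ⟨hr1, hpq⟩ := gram_sign _ _ _ hp hqp hrq hrm
  have a1 : (e0 * u0 + e1 * u1) - (e0 * f0 + e1 * f1) * (f0 * u0 + f1 * u1)
      = X * (u0 * f1 - u1 * f0) := by
    rw [hX]; linear_combination (-(e0 * u0 + e1 * u1)) * hf
  have a2 : (f0 * u0 + f1 * u1) - (e0 * u0 + e1 * u1) * (e0 * f0 + e1 * f1)
      = X * (e0 * u1 - e1 * u0) := by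
    rw [hX]; linear_combination (-(f0 * u0 + f1 * u1)) * he
  rw [a1] at hpq
  have a3 : 0 < X * (e0 * u1 - e1 * u0) := by rw [← a2]; linarith
  have hX0 : X ≠ 0 := by rintro h; rw [h] at a3; linarith
  have hXs : 0 < X ^ 2 := by positivity
  refine ⟨X * (u0 * f1 - u1 * f0) / X ^ 2, X * (e0 * u1 - e1 * u0) / X ^ 2,
    div_nonneg hpq hXs.le, div_nonneg a3.le hXs.le, ?_, ?_⟩
  · field_simp
    rw [hX]; ring
  · field_simp
    rw [hX]; ring

/-- At a top point there are two active centers whose normals span the direction. -/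
lemma top_pair (S : Finset E2) (D : Set E2) (hD : D = ⋂ c ∈ S, closedBall c 1)
    (hint : (interior D).Nonempty) (u x : E2) (hu : ‖u‖ = 1) (hx : x ∈ D)
    (hmax : ∀ y ∈ D, ⟪y, u⟫_ℝ ≤ ⟪x, u⟫_ℝ) :
    ∃ a ∈ S, ∃ b ∈ S, ∃ l m : ℝ, 0 ≤ l ∧ 0 ≤ m ∧ ‖x - a‖ = 1 ∧ ‖x - b‖ = 1 ∧
      u = l • (x - a) + m • (x - b) ∧ ⟪x - b, u⟫_ℝ ≤ ⟪x - a, u⟫_ℝ := by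
  have K := kkt_s3 S D hD hint u x hx hmax
  have huu : ⟪u, u⟫_ℝ = 1 := by rw [real_inner_self_eq_norm_sq, hu]; norm_num
  obtain ⟨c0, hc0, hc01, hc0u⟩ := K u (by rw [huu]; norm_num)
  have hne : (S.filter (fun c => ‖x - c‖ = 1)).Nonempty := ⟨c0, by simp [hc0, hc01]⟩
  obtain ⟨a, ha, hamax⟩ := Finset.exists_max_image _ (fun c => ⟪x - c, u⟫_ℝ) hne
  rw [Finset.mem_filter] at ha
  have hamax' : ∀ c ∈ S, ‖x - c‖ = 1 → ⟪x - c, u⟫_ℝ ≤ ⟪x - a, u⟫_ℝ := by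
    intro c hc h1
    exact hamax c (by simp [hc, h1])
  obtain ⟨haS, ha1⟩ := ha
  have hapos : 0 < ⟪x - a, u⟫_ℝ := by
    have := hamax' c0 hc0 hc01
    rw [real_inner_comm] at hc0u
    linarith
  obtain ⟨e, he⟩ : ∃ e, e = x - a := ⟨_, rfl⟩
  rw [← he] at ha1 hapos
  by_cases hau : e = u
  · refine ⟨a, haS, a, haS, 1, 0, by norm_num, by norm_num, by rw [← he]; exact ha1,
      by rw [← he]; exact ha1, ?_, le_rfl⟩
    rw [← he, hau]; simp
  have hlt : ⟪e, u⟫_ℝ < 1 := (inner_lt_one_iff_real_of_norm_eq_one ha1 hu).2 hau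
  obtain ⟨b, hbS, hb1, hb⟩ := K (u - ⟪e, u⟫_ℝ • e) (by
    rw [inner_sub_left, real_inner_smul_left, huu]
    nlinarith)
  have hba := hamax' b hbS hb1
  obtain ⟨f, hf⟩ : ∃ f, f = x - b := ⟨_, rfl⟩
  rw [← he] at hba
  rw [← hf] at hb1 hb hba
  have key : ∃ l m : ℝ, 0 ≤ l ∧ 0 ≤ m ∧ u = l • e + m • f := by
    have e1 : e 0 ^ 2 + e 1 ^ 2 = 1 := by rw [← normsq_coord, ha1]; norm_num
    have f1 : f 0 ^ 2 + f 1 ^ 2 = 1 := by rw [← normsq_coord, hb1]; norm_num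
    have u1 : u 0 ^ 2 + u 1 ^ 2 = 1 := by rw [← normsq_coord, hu]; norm_num
    rw [inner_sub_left, real_inner_smul_left] at hb
    simp only [inner_coord] at hb hba hapos hlt
    obtain ⟨l, m, hl, hm, h0, h1⟩ := gram (e 0) (e 1) (f 0) (f 1) (u 0) (u 1) e1 f1 hapos hba
      (by linarith)
    refine ⟨l, m, hl, hm, ?_⟩
    ext i
    fin_cases i
    · simpa using h0
    · simpa using h1
  obtain ⟨l, m, hl, hm, hlm⟩ := key
  refine ⟨a, haS, b, hbS, l, m, hl, hm, ?_, ?_, ?_, ?_⟩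
  · rw [← he]; exact ha1
  · rw [← hf]; exact hb1
  · rw [← he, ← hf]; exact hlm
  · rw [← he, ← hf]; exact hba

/-- The better of the two centers is close to the direction. -/
lemma angle_bound (e f u : E2) (he : ‖e‖ = 1) (hf : ‖f‖ = 1) (hu : ‖u‖ = 1) (l m d k : ℝ)
    (hl : 0 ≤ l) (hm : 0 ≤ m) (hk : 0 < k) (hkd : 4 * k ^ 2 = 4 - d ^ 2)
    (hulm : u = l • e + m • f) (hef : ‖e - f‖ ^ 2 ≤ d ^ 2) (hle : ⟪f, u⟫_ℝ ≤ ⟪e, u⟫_ℝ) :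
    k ≤ ⟪e, u⟫_ℝ := by
  have h1 : ‖u‖ ^ 2 = l ^ 2 + 2 * (l * m) * ⟪e, f⟫_ℝ + m ^ 2 := by
    rw [hulm, norm_add_sq_real, norm_smul, norm_smul, he, hf, real_inner_smul_left,
      real_inner_smul_right, Real.norm_of_nonneg hl, Real.norm_of_nonneg hm]
    ring
  have h2 : ‖u‖ ^ 2 = l * ⟪e, u⟫_ℝ + m * ⟪f, u⟫_ℝ := by
    rw [← real_inner_self_eq_norm_sq]
    have h : ⟪u, u⟫_ℝ = ⟪l • e + m • f, u⟫_ℝ := by rw [← hulm]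
    rw [h, inner_add_left, real_inner_smul_left, real_inner_smul_left]
  have h3 := norm_sub_sq_real e f
  rw [he, hf] at h3
  rw [hu] at h1 h2
  have hc : 2 * k ^ 2 - 1 ≤ ⟪e, f⟫_ℝ := by nlinarith
  have hc1 : ⟪e, f⟫_ℝ ≤ 1 := by
    have := real_inner_le_norm e f
    rw [he, hf] at this; linarith
  have h4 : 1 ≤ (l + m) * ⟪e, u⟫_ℝ := by nlinarith
  have h5 : ((l + m) * k) ^ 2 ≤ 1 ^ 2 := by
    have a := mul_le_mul_of_nonneg_left hc (mul_nonneg hl hm)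
    have b : 0 ≤ (l - m) ^ 2 * (1 - k ^ 2) := mul_nonneg (sq_nonneg _) (by linarith)
    nlinarith
  have h6 : (l + m) * k ≤ 1 := abs_le_of_sq_le_sq' h5 (by norm_num) |>.2
  have h7 : 0 < l + m := by
    rcases (add_nonneg hl hm).eq_or_lt with h | h
    · rw [← h] at h4; linarith
    · exact h
  exact le_of_mul_le_mul_left (h6.trans h4) h7

lemma frame_normsq (u f : E2) (hu : ‖u‖ = 1) :
    (f 0 * u 1 - f 1 * u 0) ^ 2 + (f 0 * u 0 + f 1 * u 1) ^ 2 = ‖f‖ ^ 2 := by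
  have u1 : u 0 ^ 2 + u 1 ^ 2 = 1 := by rw [← normsq_coord, hu]; norm_num
  rw [normsq_coord]; linear_combination (f 0 ^ 2 + f 1 ^ 2) * u1

/-- A critical strip has width at least the claimed bound. -/
lemma critical_strip (d k r0 w : ℝ) (hk : 0 < k) (hkd : 4 * k ^ 2 = 4 - d ^ 2)
    (hr0 : 0 ≤ r0) (hr : r0 ^ 2 + 2 * r0 * k = d ^ 2 - 1) (hw : 0 ≤ w) (hd0 : 0 ≤ d)
    (S : Finset E2) (D : Set E2) (hD : D = ⋂ c ∈ S, closedBall c 1)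
    (hint : (interior D).Nonempty) (hcp : ∀ c ∈ S, ∀ c' ∈ S, dist c c' ≤ d)
    (u x y : E2) (hu : ‖u‖ = 1) (hx : x ∈ D) (hy : y ∈ D)
    (hmax : ∀ z ∈ D, ⟪z, u⟫_ℝ ≤ ⟪x, u⟫_ℝ) (hmin : ∀ z ∈ D, ⟪y, u⟫_ℝ ≤ ⟪z, u⟫_ℝ)
    (hxy : x - y = w • u) : 1 - r0 ≤ w := by
  by_contra hcon
  push Not at hcon
  have hcp2 : ∀ c ∈ S, ∀ c' ∈ S, ‖c - c'‖ ^ 2 ≤ d ^ 2 := by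
    intro c hc c' hc'
    have := hcp c hc c' hc'
    rw [dist_eq_norm] at this
    exact pow_le_pow_left₀ (norm_nonneg _) this 2
  obtain ⟨a, ha, b, hb, l1, m1, hl1, hm1, ha1, hb1, hu1, hab⟩ :=
    top_pair S D hD hint u x hu hx hmax
  have hke : k ≤ ⟪x - a, u⟫_ℝ := by
    apply angle_bound (x - a) (x - b) u ha1 hb1 hu l1 m1 d k hl1 hm1 hk hkd hu1 _ hab
    have : x - a - (x - b) = b - a := by abel
    rw [this]
    exact hcp2 b hb a ha
  obtain ⟨p, hp, q, hq, l, m, hl, hm, hp1, hq1, hu2, -⟩ :=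
    top_pair S D hD hint (-u) y (by rw [norm_neg, hu]) hy (by
      intro z hz
      rw [inner_neg_right, inner_neg_right]
      linarith [hmin z hz])
  have hu2' : u = l • (p - y) + m • (q - y) := by
    rw [← neg_neg u, hu2, neg_add, ← smul_neg, ← smul_neg, neg_sub, neg_sub]
  have hp1' : ‖p - y‖ = 1 := by rw [norm_sub_rev]; exact hp1
  have hq1' : ‖q - y‖ = 1 := by rw [norm_sub_rev]; exact hq1
  obtain ⟨e, he⟩ : ∃ e, e = x - a := ⟨_, rfl⟩
  obtain ⟨f, hf⟩ : ∃ f, f = p - y := ⟨_, rfl⟩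
  obtain ⟨g, hg⟩ : ∃ g, g = q - y := ⟨_, rfl⟩
  rw [← he] at ha1 hke
  rw [← hf] at hp1'
  rw [← hg] at hq1'
  rw [← hf, ← hg] at hu2'
  have Lfg : ‖f - g‖ ^ 2 ≤ d ^ 2 := by
    have : f - g = p - q := by rw [hf, hg]; abel
    rw [this]; exact hcp2 p hp q hq
  have hxy' : x = y + w • u := by rw [← hxy]; abel
  have Lfc : ‖f + e - w • u‖ ^ 2 ≤ d ^ 2 := by
    have : f + e - w • u = p - a := by rw [hf, he, hxy']; abel
    rw [this]; exact hcp2 p hp a ha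
  have Lgc : ‖g + e - w • u‖ ^ 2 ≤ d ^ 2 := by
    have : g + e - w • u = q - a := by rw [hg, he, hxy']; abel
    rw [this]; exact hcp2 q hq a ha
  have u1 : u 0 ^ 2 + u 1 ^ 2 = 1 := by rw [← normsq_coord, hu]; norm_num
  have c0 : u 0 = l * f 0 + m * g 0 := by
    have := congrArg (fun z : E2 => z 0) hu2'
    simpa using this
  have c1 : u 1 = l * f 1 + m * g 1 := by
    have := congrArg (fun z : E2 => z 1) hu2'
    simpa using this
  rw [inner_coord] at hke
  rw [← frame_normsq u _ hu] at Lfg Lfc Lgc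
  simp only [PiLp.sub_apply, PiLp.add_apply, PiLp.smul_apply, smul_eq_mul] at Lfg Lfc Lgc
  have conv : ∀ h : E2, ((h 0 + e 0 - w * u 0) * u 1 - (h 1 + e 1 - w * u 1) * u 0) ^ 2 +
      ((h 0 + e 0 - w * u 0) * u 0 + (h 1 + e 1 - w * u 1) * u 1) ^ 2 =
      ((h 0 * u 1 - h 1 * u 0) + (e 0 * u 1 - e 1 * u 0)) ^ 2 +
      ((h 0 * u 0 + h 1 * u 1) - (w - (e 0 * u 0 + e 1 * u 1))) ^ 2 := by
    intro h
    have e1 : (h 0 + e 0 - w * u 0) * u 0 + (h 1 + e 1 - w * u 1) * u 1 =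
      (h 0 * u 0 + h 1 * u 1) - (w - (e 0 * u 0 + e 1 * u 1)) := by
      linear_combination (-w) * u1
    rw [e1]; ring
  rw [conv] at Lfc Lgc
  refine core_frame d k r0 w (e 0 * u 1 - e 1 * u 0) (e 0 * u 0 + e 1 * u 1)
    (f 0 * u 1 - f 1 * u 0) (f 0 * u 0 + f 1 * u 1)
    (g 0 * u 1 - g 1 * u 0) (g 0 * u 0 + g 1 * u 1) l m hk hkd hr0 hr hw (by linarith)
    ?_ hke ?_ ?_ hl hm ?_ ?_ ?_ Lfc Lgc
  · rw [frame_normsq u e hu, ha1]; norm_num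
  · rw [frame_normsq u f hu, hp1']; norm_num
  · rw [frame_normsq u g hu, hq1']; norm_num
  · linear_combination u 0 * c1 - u 1 * c0
  · linear_combination u1 - u 0 * c0 - u 1 * c1
  · refine le_trans (le_of_eq ?_) Lfg
    ring

/-- Existence of a critical strip realising the minimal width. -/
lemma exists_critical (D : Set E2) (hc : IsCompact D) (hconv : Convex ℝ D) (hne : D.Nonempty) :
    ∃ u x y : E2, ∃ w : ℝ, ‖u‖ = 1 ∧ x ∈ D ∧ y ∈ D ∧ 0 ≤ w ∧ x - y = w • u ∧
      (∀ z ∈ D, ⟪z, u⟫_ℝ ≤ ⟪x, u⟫_ℝ) ∧ (∀ z ∈ D, ⟪y, u⟫_ℝ ≤ ⟪z, u⟫_ℝ) ∧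
      ∀ v : E2, ‖v‖ = 1 → w ≤ dirWidth D v := by
  have hKc : IsCompact (D - D) := by simpa [sub_eq_add_neg] using hc.add hc.neg
  have hKconv : Convex ℝ (D - D) := hconv.sub hconv
  have hset : ∀ v : E2, {w : ℝ | ∃ x ∈ D, ∃ y ∈ D, w = ⟪x - y, v⟫_ℝ}
      = (fun z => ⟪z, v⟫_ℝ) '' (D - D) := by
    intro v
    ext w
    constructor
    · rintro ⟨x, hx, y, hy, rfl⟩
      exact ⟨x - y, Set.sub_mem_sub hx hy, rfl⟩
    · rintro ⟨z, ⟨x, hx, y, hy, rfl⟩, rfl⟩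
      exact ⟨x, hx, y, hy, rfl⟩
  have hbdd : ∀ v : E2, BddAbove ((fun z => ⟪z, v⟫_ℝ) '' (D - D)) := fun v =>
    (hKc.image (by fun_prop)).bddAbove
  have hle : ∀ v : E2, ∀ z ∈ D - D, ⟪z, v⟫_ℝ ≤ dirWidth D v := by
    intro v z hz
    unfold dirWidth
    rw [hset v]
    exact le_csSup (hbdd v) ⟨z, hz, rfl⟩
  have hcont : Continuous (fun v : E2 => dirWidth D v) := by
    have h := hKc.continuous_sSup (f := fun (v : E2) (z : E2) => ⟪z, v⟫_ℝ) (by fun_prop)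
    refine h.congr ?_
    intro v
    unfold dirWidth
    rw [hset v]
  have hsph : (sphere (0 : E2) 1).Nonempty := (NormedSpace.sphere_nonempty).2 zero_le_one
  obtain ⟨u, hu, humin⟩ := (isCompact_sphere (0 : E2) 1).exists_isMinOn hsph hcont.continuousOn
  have hu1 : ‖u‖ = 1 := by simpa using hu
  have humin' : ∀ v : E2, ‖v‖ = 1 → dirWidth D u ≤ dirWidth D v := by
    intro v hv
    exact humin (by simpa using hv)
  obtain ⟨w, hw⟩ : ∃ w, w = dirWidth D u := ⟨_, rfl⟩
  obtain ⟨x0, hx0⟩ := hne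
  have hw0 : 0 ≤ w := by
    have := hle u (x0 - x0) (Set.sub_mem_sub hx0 hx0)
    rw [sub_self, inner_zero_left] at this
    rw [hw]; exact this
  have hmem : w • u ∈ D - D := by
    by_contra hnot
    obtain ⟨φ, s, h1, h2⟩ := geometric_hahn_banach_closed_point hKconv hKc.isClosed hnot
    obtain ⟨v, hv⟩ := (InnerProductSpace.toDual ℝ E2).surjective φ
    have hφ : ∀ z, φ z = ⟪z, v⟫_ℝ := by
      intro z; rw [← hv, InnerProductSpace.toDual_apply_apply, real_inner_comm]
    have hs0 : 0 < s := by
      have := h1 (x0 - x0) (Set.sub_mem_sub hx0 hx0)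
      rwa [sub_self, map_zero] at this
    have hv0 : v ≠ 0 := by
      rintro rfl
      rw [hφ, inner_zero_right] at h2
      linarith
    have hvn : 0 < ‖v‖ := norm_pos_iff.2 hv0
    have hb : dirWidth D (‖v‖⁻¹ • v) ≤ ‖v‖⁻¹ * s := by
      unfold dirWidth
      rw [hset]
      apply csSup_le
      · exact ⟨_, x0 - x0, Set.sub_mem_sub hx0 hx0, rfl⟩
      · rintro _ ⟨z, hz, rfl⟩
        have := h1 z hz
        rw [hφ] at this
        simp only [real_inner_smul_right]
        exact mul_le_mul_of_nonneg_left this.le (by positivity)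
    have hb2 := humin' (‖v‖⁻¹ • v) (by rw [norm_smul, norm_inv, norm_norm, inv_mul_cancel₀ hvn.ne'])
    rw [hφ, real_inner_smul_left] at h2
    have h3 : ⟪u, v⟫_ℝ ≤ ‖v‖ := by
      have := real_inner_le_norm u v
      rwa [hu1, one_mul] at this
    have h4 : s < w * ‖v‖ := h2.trans_le (mul_le_mul_of_nonneg_left h3 hw0)
    have h5 : w ≤ ‖v‖⁻¹ * s := by rw [hw]; exact hb2.trans hb
    have h6 : w * ‖v‖ ≤ s := by
      have := mul_le_mul_of_nonneg_right h5 hvn.le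
      rwa [mul_comm ‖v‖⁻¹ s, mul_assoc, inv_mul_cancel₀ hvn.ne', mul_one] at this
    linarith
  obtain ⟨x, hx, y, hy, hxy⟩ := Set.mem_sub.1 hmem
  have hxyu : ⟪x, u⟫_ℝ - ⟪y, u⟫_ℝ = w := by
    rw [← inner_sub_left, hxy, real_inner_smul_left, real_inner_self_eq_norm_sq, hu1]; ring
  refine ⟨u, x, y, w, hu1, hx, hy, hw0, hxy, ?_, ?_, ?_⟩
  · intro z hz
    have := hle u (z - y) (Set.sub_mem_sub hz hy)
    rw [inner_sub_left] at this
    linarith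
  · intro z hz
    have := hle u (x - z) (Set.sub_mem_sub hx hz)
    rw [inner_sub_left] at this
    linarith
  · intro v hv
    rw [hw]; exact humin' v hv

/-- Lemma 2 of the paper: a disk-polygon with center parameter `d`, `1 ≤ d < √3`,
has minimal width at least `w(Δ(d))`. -/
theorem minWidth_ge (d : ℝ) (hd1 : 1 ≤ d) (hd2 : d < Real.sqrt 3)
    (S : Finset E2) (hS : S.Nonempty) (D : Set E2)
    (hD : D = ⋂ c ∈ S, closedBall c 1) (hint : (interior D).Nonempty)
    (hcp : ∀ c ∈ S, ∀ c' ∈ S, dist c c' ≤ d) :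
    1 - 1 / 2 * Real.sqrt (4 + 2 * d ^ 2 - 2 * Real.sqrt 3 * d * Real.sqrt (4 - d ^ 2))
      ≤ minWidth D := by
  have hs3 : Real.sqrt 3 ^ 2 = 3 := Real.sq_sqrt (by norm_num)
  have hs30 : 0 ≤ Real.sqrt 3 := Real.sqrt_nonneg _
  have hd3 : d ^ 2 < 3 := by nlinarith
  have hq2 : Real.sqrt (4 - d ^ 2) ^ 2 = 4 - d ^ 2 := Real.sq_sqrt (by linarith)
  have hq0 : 0 < Real.sqrt (4 - d ^ 2) := Real.sqrt_pos.2 (by linarith)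
  obtain ⟨t, ht⟩ : ∃ t, t = Real.sqrt 3 := ⟨_, rfl⟩
  obtain ⟨q, hq⟩ : ∃ q, q = Real.sqrt (4 - d ^ 2) := ⟨_, rfl⟩
  rw [← ht] at hs3 hs30
  rw [← hq] at hq2 hq0
  rw [← ht, ← hq]
  have hqt : q ≤ t * d := by
    apply abs_le_of_sq_le_sq' _ (by positivity) |>.2
    rw [hq2, mul_pow, hs3]; nlinarith
  have hsq : Real.sqrt (4 + 2 * d ^ 2 - 2 * t * d * q) = t * d - q := by
    have h : 4 + 2 * d ^ 2 - 2 * t * d * q = (t * d - q) ^ 2 := by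
      linear_combination (-(d ^ 2)) * hs3 - hq2
    rw [h]
    exact Real.sqrt_sq (by linarith)
  rw [hsq]
  have hDc : IsCompact D := by
    obtain ⟨c, hc⟩ := hS
    apply (isCompact_closedBall c 1).of_isClosed_subset
    · rw [hD]
      exact isClosed_biInter fun _ _ => isClosed_closedBall
    · rw [hD]
      exact Set.biInter_subset_of_mem hc
  have hDconv : Convex ℝ D := by
    rw [hD]
    exact convex_iInter₂ fun c _ => convex_closedBall c 1
  obtain ⟨u, x, y, w, hu, hx, hy, hw, hxy, hmax, hmin, hall⟩ :=
    exists_critical D hDc hDconv (hint.mono interior_subset)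
  have key := critical_strip d (q / 2) ((t * d - q) / 2) w (by linarith) (by linarith)
    (by linarith) (by linear_combination (d ^ 2 / 4) * hs3 - (1 / 4) * hq2) hw (by linarith)
    S D hD hint hcp u x y hu hx hy hmax hmin hxy
  unfold minWidth
  apply le_csInf
  · exact ⟨_, u, hu, rfl⟩
  · rintro _ ⟨v, hv, rfl⟩
    have := hall v hv
    linarith
end
end
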